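/- arXiv:2404.16199 — 2 statements merged into one kernel-verified Lean document; each statement's English description precedes it below -/
import Mathlib

section
/- For every integer n ≥ 0, t^{1/2}(2, {1}^n, 2) = ((n+3)/2^{n+2})·t(n+4) = ((n+3)/2^{n+2})·(1 − 2^{−(n+4)})·ζ(n+4). -/
/-- The monotone index sequence `n_0 ≤ n_1 ≤ ⋯` of positive integers parametrized by the
gap function `g`: `n i = 1 + g 0 + g 1 + ⋯ + g i`.  Every weakly increasing tuple
`1 ≤ n_0 ≤ ⋯ ≤ n_{d−1}` arises from exactly one `g : Fin d → ℕ`, and `n i = n (i+1)`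
holds iff `g (i+1) = 0`. -/
def idxSeq {d : ℕ} (g : Fin d → ℕ) (i : Fin d) : ℕ :=
  1 + ∑ j ∈ Finset.univ.filter (· ≤ i), g j

/-- The number of equalities `n i = n (i+1)` among consecutive entries of the index
sequence, i.e. the number of indices `i ≠ 0` with `g i = 0`. -/
def repCount {d : ℕ} (g : Fin d → ℕ) : ℕ :=
  (Finset.univ.filter (fun i : Fin d => (i : ℕ) ≠ 0 ∧ g i = 0)).card

/-- The interpolated multiple t value
`t^r(s₁,…,s_d) = ∑_{1 ≤ n₁ ≤ ⋯ ≤ n_d} r^{#{i : n_i = n_{i+1}}} / ∏ (2nᵢ−1)^{sᵢ}`. -/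
noncomputable def tInterp (r : ℝ) {d : ℕ} (s : Fin d → ℕ) : ℝ :=
  ∑' g : Fin d → ℕ,
    r ^ repCount g * ∏ i, 1 / (2 * (idxSeq g i : ℝ) - 1) ^ s i


open Real Set Filter Topology MeasureTheory

namespace THalf

lemma lint_ftc {G g : ℝ → ℝ} {a l l0 : ℝ} (hd : ∀ x, a < x → HasDerivAt G (g x) x)
    (hg : ∀ x, a < x → 0 ≤ g x) (h0 : Tendsto G (𝓝[>] a) (𝓝 l0))
    (h1 : Tendsto G atTop (𝓝 l)) :
    ∫⁻ x in Ioi a, ENNReal.ofReal (g x) = ENNReal.ofReal (l - l0) := by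
  classical
  set H : ℝ → ℝ := Function.update G a l0 with hH
  have hHa : H a = l0 := by simp [hH]
  have hHG : ∀ x, a < x → H =ᶠ[𝓝 x] G := by
    intro x hx
    filter_upwards [lt_mem_nhds hx] with y hy
    simp [hH, Function.update_of_ne (ne_of_gt hy)]
  have hd' : ∀ x ∈ Ioi a, HasDerivAt H (g x) x := fun x hx =>
    (hd x hx).congr_of_eventuallyEq (hHG x hx)
  have hc : ContinuousWithinAt H (Ici a) a := by
    rw [continuousWithinAt_update_same]
    have : Ici a \ {a} = Ioi a := by ext; simp [lt_iff_le_and_ne]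
    rwa [this]
  have ht : Tendsto H atTop (𝓝 l) := by
    refine h1.congr' ?_
    filter_upwards [eventually_gt_atTop a] with y hy
    simp [hH, Function.update_of_ne (ne_of_gt hy)]
  have hi := integrableOn_Ioi_deriv_of_nonneg hc hd' hg ht
  have he := integral_Ioi_of_hasDerivAt_of_nonneg hc hd' hg ht
  rw [← ofReal_integral_eq_lintegral_ofReal hi, he, hHa]
  filter_upwards [ae_restrict_mem measurableSet_Ioi] with x hx using hg x hx

lemma lint_exp (c m q : ℝ) (hc : 0 ≤ c) (hm : 0 < m) :
    ∫⁻ p in Ioi q, ENNReal.ofReal (c * exp (-m * p)) =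
      ENNReal.ofReal (c * exp (-m * q) / m) := by
  have h := lint_ftc (G := fun p => -(c * exp (-m * p) / m)) (g := fun p => c * exp (-m * p))
    (a := q) (l := 0) (l0 := -(c * exp (-m * q) / m)) ?_ ?_ ?_ ?_
  · rw [h]; congr 1; ring
  · intro x _
    have := ((((hasDerivAt_id x).const_mul (-m)).exp.const_mul c).div_const m).neg
    refine HasDerivAt.congr_deriv this ?_
    simp only [id]
    field_simp
  · intro x _; positivity
  · have : Continuous fun p => -(c * exp (-m * p) / m) := by fun_prop
    exact (this.tendsto q).mono_left nhdsWithin_le_nhds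
  · have : Tendsto (fun p : ℝ => -m * p) atTop atBot :=
      tendsto_id.const_mul_atTop_of_neg (by linarith)
    have := (((tendsto_exp_atBot.comp this).const_mul c).div_const m).neg
    simpa using this

lemma tonelli {u g : ℝ → ENNReal} (hu : Measurable u) (hg : Measurable g) :
    ∫⁻ q in Ioi (0:ℝ), (∫⁻ p in Ioi q, g p) * u q =
      ∫⁻ p in Ioi (0:ℝ), g p * ∫⁻ q in Ioo 0 p, u q := by
  have e1 : ∀ q : ℝ, (∫⁻ p in Ioi q, g p) * u q
      = ∫⁻ p, ({z : ℝ × ℝ | z.1 < z.2}.indicator (fun z => g z.2 * u z.1)) (q, p) := by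
    intro q
    rw [← lintegral_mul_const _ hg, ← lintegral_indicator measurableSet_Ioi]
    rfl
  have e2 : ∀ p : ℝ, g p * (∫⁻ q in Ioo 0 p, u q)
      = ∫⁻ q in Ioi (0:ℝ), ({z : ℝ × ℝ | z.1 < z.2}.indicator (fun z => g z.2 * u z.1)) (q, p) := by
    intro p
    rw [← lintegral_const_mul _ hu, ← lintegral_indicator measurableSet_Ioi,
      ← lintegral_indicator measurableSet_Ioo]
    congr 1; ext q
    by_cases h1 : 0 < q <;> by_cases h2 : q < p <;> simp [indicator, h1, h2]
  have hm : Measurable ({z : ℝ × ℝ | z.1 < z.2}.indicator (fun z => g z.2 * u z.1)) := by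
    refine Measurable.indicator ?_ (measurableSet_lt measurable_fst measurable_snd)
    fun_prop
  simp_rw [e1, e2]
  rw [lintegral_lintegral_swap (f := fun q p => ({z : ℝ × ℝ | z.1 < z.2}.indicator (fun z => g z.2 * u z.1)) (q, p)) hm.aemeasurable]
  rw [← lintegral_indicator measurableSet_Ioi]
  congr 1; ext p
  by_cases h : 0 < p
  · simp [h]
  · rw [indicator_of_notMem (by simpa using h)]
    have := e2 p
    rw [Ioo_eq_empty h] at this
    rw [← this]; simp

lemma subst_lem (f : ℝ → ENNReal) {p : ℝ} (hp : 0 < p) :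
    ∫⁻ q in Ioo 0 p, ENNReal.ofReal (cosh q / sinh q) * f (sinh q) =
      ∫⁻ τ in Ioi (0:ℝ), f (exp (-τ) * sinh p) := by
  have hs : 0 < sinh p := sinh_pos_iff.2 hp
  have him : (fun τ => arsinh (exp (-τ) * sinh p)) '' Ioi 0 = Ioo 0 p := by
    ext q
    simp only [mem_image, mem_Ioi, mem_Ioo]
    constructor
    · rintro ⟨τ, hτ, rfl⟩
      refine ⟨arsinh_pos_iff.2 (by positivity), ?_⟩
      have : exp (-τ) * sinh p < sinh p := by
        have : exp (-τ) < 1 := Real.exp_lt_one_iff.2 (by linarith)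
        nlinarith
      calc _ < arsinh (sinh p) := arsinh_lt_arsinh.2 this
        _ = p := arsinh_sinh p
    · rintro ⟨h0, h1⟩
      have hq : 0 < sinh q := sinh_pos_iff.2 h0
      refine ⟨log (sinh p / sinh q), log_pos ?_, ?_⟩
      · rw [one_lt_div hq]; exact sinh_lt_sinh.2 h1
      · rw [exp_neg, exp_log (by positivity), inv_div, div_mul_cancel₀ _ hs.ne', arsinh_sinh]
  rw [← him, lintegral_image_eq_lintegral_abs_deriv_mul measurableSet_Ioi
    (f' := fun τ => -(exp (-τ) * sinh p) * (√(1 + (exp (-τ) * sinh p)^2))⁻¹)]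
  · refine setLIntegral_congr_fun measurableSet_Ioi fun τ hτ => ?_
    simp only [sinh_arsinh, cosh_arsinh]
    rw [← mul_assoc, ← ENNReal.ofReal_mul (abs_nonneg _)]
    have h1 : 0 < exp (-τ) * sinh p := by positivity
    have h2 : 0 < √(1 + (exp (-τ) * sinh p)^2) := by positivity
    have : |-(exp (-τ) * sinh p) * (√(1 + (exp (-τ) * sinh p)^2))⁻¹| *
      (√(1 + (exp (-τ) * sinh p)^2) / (exp (-τ) * sinh p)) = 1 := by
      rw [abs_mul, abs_neg, abs_of_pos h1, abs_of_pos (inv_pos.2 h2)]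
      field_simp
    rw [this]; simp
  · intro τ _
    have h := (((hasDerivAt_id τ).neg.exp).mul_const (sinh p)).arsinh
    refine HasDerivAt.hasDerivWithinAt ?_
    refine HasDerivAt.congr_deriv h ?_
    simp [mul_comm]
  · intro x _ y _ h
    have h := arsinh_injective h
    have := exp_injective (mul_right_cancel₀ hs.ne' h)
    linarith


/-- closed form of `∑ e^{-mq}/m` over odd `m` -/
noncomputable def psiR (q : ℝ) : ℝ := (log (1 + cosh q) - log (sinh q)) / 2

noncomputable def psi (q : ℝ) : ENNReal :=
  ∑' k : ℕ, ENNReal.ofReal (1 / (2 * (k:ℝ) + 1) * exp (-(2 * (k:ℝ) + 1) * q))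

noncomputable def FF (x : ℝ) : ℝ := x / (√(1 + x ^ 2)) ^ 3

lemma psi_eq {q : ℝ} (hq : 0 < q) : psi q = ENNReal.ofReal (psiR q) := by
  have hx1 : exp (-q) < 1 := Real.exp_lt_one_iff.2 (by linarith)
  have hx0 := exp_pos (-q)
  have hs : 0 < sinh q := sinh_pos_iff.2 hq
  have hc := cosh_pos q
  have h := hasSum_log_sub_log_of_abs_lt_one (x := exp (-q)) (by rw [abs_of_pos hx0]; exact hx1)
  have e : log (1 + exp (-q)) - log (1 - exp (-q)) = log (1 + cosh q) - log (sinh q) := by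
    have h1 : 0 < 1 - exp (-q) := by linarith
    rw [← log_div (by positivity) (by positivity), ← log_div (by positivity) (by positivity)]
    congr 1
    rw [div_eq_div_iff h1.ne' hs.ne', cosh_eq, sinh_eq]
    have : exp (-q) * exp q = 1 := by rw [← exp_add]; simp
    linear_combination (1/2 + 1/2) * this
  rw [e] at h
  have h2 : HasSum (fun k : ℕ => 1 / (2 * (k:ℝ) + 1) * exp (-(2 * (k:ℝ) + 1) * q)) (psiR q) := by
    refine (h.div_const 2).congr_fun ?_ 
    intro k
    rw [← exp_nat_mul]
    have : ((2 * k + 1 : ℕ) : ℝ) * -q = -(2 * (k:ℝ) + 1) * q := by push_cast; ring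
    rw [this]; ring
  rw [psi, ← ENNReal.ofReal_tsum_of_nonneg _ h2.summable, h2.tsum_eq]
  intro k; positivity

lemma psi_meas : Measurable psi := by
  unfold psi
  refine Measurable.tsum fun k => ?_
  fun_prop

lemma psiR_arsinh {q : ℝ} (hq : 0 < q) : psiR q = arsinh (1 / sinh q) / 2 := by
  have hs : 0 < sinh q := sinh_pos_iff.2 hq
  have hc := cosh_pos q
  rw [psiR, arsinh, ← log_div (by positivity) (by positivity)]
  congr 2
  have : 1 + (1 / sinh q) ^ 2 = (cosh q / sinh q) ^ 2 := by
    field_simp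
    rw [cosh_sq]; try ring
  rw [this, sqrt_sq (by positivity)]
  field_simp

lemma psiR_deriv {q : ℝ} (hq : 0 < q) : HasDerivAt psiR (-1 / (2 * sinh q)) q := by
  have hs : 0 < sinh q := sinh_pos_iff.2 hq
  have hc := cosh_pos q
  have h := ((((hasDerivAt_cosh q).const_add 1).log (by positivity)).sub
    ((hasDerivAt_sinh q).log hs.ne')).div_const 2
  refine HasDerivAt.congr_deriv h ?_
  have := cosh_sq q
  field_simp
  linear_combination -this

lemma tendsto_sinh_top : Tendsto sinh atTop atTop := by
  refine tendsto_atTop_mono' atTop ?_ tendsto_id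
  filter_upwards [eventually_ge_atTop 0] with x hx
  exact self_le_sinh_iff.2 hx

lemma psiR_tendsto : Tendsto psiR atTop (𝓝 0) := by
  have h1 : Tendsto (fun q => 1 / sinh q) atTop (𝓝 0) := by
    exact tendsto_sinh_top.inv_tendsto_atTop.congr (fun q => by simp)
  have h2 := ((continuous_arsinh.tendsto 0).comp h1).div_const 2
  simp only [arsinh_zero, zero_div] at h2
  refine h2.congr' ?_
  filter_upwards [eventually_gt_atTop 0] with q hq
  rw [psiR_arsinh hq]; rfl

lemma psiR_nonneg {q : ℝ} (hq : 0 < q) : 0 ≤ psiR q := by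
  rw [psiR_arsinh hq]
  have hs : 0 < sinh q := sinh_pos_iff.2 hq
  have := arsinh_nonneg_iff.2 (by positivity : 0 ≤ 1 / sinh q)
  positivity

/-- the auxiliary bracket in the antiderivative -/
noncomputable def brk (l q : ℝ) : ℝ :=
  cosh q / √(1 + (l * sinh q) ^ 2) * psiR q
    - (log (1 + √(1 + (l * sinh q) ^ 2)) - log l - log (sinh q)) / 2

lemma brk_deriv {l q : ℝ} (hl0 : 0 < l) (hl1 : l < 1) (hq : 0 < q) :
    HasDerivAt (fun q => l / (1 - l ^ 2) * brk l q) (psiR q * FF (l * sinh q)) q := by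
  have hs : 0 < sinh q := sinh_pos_iff.2 hq
  have hc := cosh_pos q
  have hl2 : 0 < 1 - l ^ 2 := by nlinarith
  have hp : 0 < 1 + (l * sinh q) ^ 2 := by positivity
  have hR := sqrt_pos.2 hp
  have hRd := ((((hasDerivAt_sinh q).const_mul l).pow 2).const_add 1).sqrt hp.ne'
  have h := ((((hasDerivAt_cosh q).div hRd hR.ne').mul (psiR_deriv hq)).sub
    ((((hRd.const_add 1).log (by positivity)).sub_const (log l)).sub
      ((hasDerivAt_sinh q).log hs.ne') |>.div_const 2)).const_mul (l / (1 - l ^ 2))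
  refine HasDerivAt.congr_deriv h ?_
  have hR2 : √(1 + (l * sinh q) ^ 2) ^ 2 = 1 + (l * sinh q) ^ 2 := sq_sqrt hp.le
  have hC := cosh_sq q
  simp only [FF]
  simp only [Pi.pow_apply, Pi.div_apply]
  generalize √(1 + (l * sinh q) ^ 2) = R at *
  generalize psiR q = P at *
  generalize sinh q = S at *
  generalize cosh q = C at *
  have e1 : S / R - C * (l ^ 2 * S * C / R) / R ^ 2 = S * (1 - l ^ 2) / R ^ 3 := by
    field_simp
    rw [hR2, hC]; ring
  have e2 : C / R * (-1 / (2 * S)) - ((l ^ 2 * S * C / R) / (1 + R) - C / S) / 2 = 0 := by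
    field_simp
    linear_combination C * hR2
  have e3 : l / (1 - l ^ 2) * ((S / R - C * (l ^ 2 * S * C / R) / R ^ 2) * P
     + (C / R * (-1 / (2 * S)) - ((l ^ 2 * S * C / R) / (1 + R) - C / S) / 2)) =
      P * (l * S / R ^ 3) := by
    rw [e1, e2]; field_simp; ring
  rw [← e3]
  field_simp
  push_cast
  ring

lemma brk_top {l : ℝ} (hl0 : 0 < l) (hl1 : l < 1) : Tendsto (brk l) atTop (𝓝 0) := by
  have h1 : Tendsto (fun q => cosh q / √(1 + (l * sinh q) ^ 2) * psiR q) atTop (𝓝 0) := by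
    have hb := psiR_tendsto.const_mul (1 / l)
    rw [mul_zero] at hb
    refine tendsto_of_tendsto_of_tendsto_of_le_of_le' tendsto_const_nhds hb ?_ ?_
    · filter_upwards [eventually_gt_atTop 0] with q hq
      have := psiR_nonneg hq
      have := cosh_pos q
      positivity
    · filter_upwards [eventually_gt_atTop 0] with q hq
      refine mul_le_mul_of_nonneg_right ?_ (psiR_nonneg hq)
      have hp : 0 < 1 + (l * sinh q) ^ 2 := by positivity
      rw [div_le_div_iff₀ (sqrt_pos.2 hp) hl0, one_mul]
      refine le_sqrt_of_sq_le ?_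
      rw [mul_pow, cosh_sq]
      nlinarith
  have h2 : Tendsto (fun q => arsinh (1 / (l * sinh q)) / 2) atTop (𝓝 0) := by
    have h1 : Tendsto (fun q => 1 / (l * sinh q)) atTop (𝓝 0) := by
      exact (tendsto_sinh_top.const_mul_atTop hl0).inv_tendsto_atTop.congr (fun q => by simp)
    have h2 := ((continuous_arsinh.tendsto 0).comp h1).div_const 2
    simpa using h2
  have h3 := h1.sub h2
  rw [sub_zero] at h3
  refine h3.congr' ?_
  filter_upwards [eventually_gt_atTop 0] with q hq
  have hs : 0 < sinh q := sinh_pos_iff.2 hq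
  have hp : 0 < 1 + (l * sinh q) ^ 2 := by positivity
  have hR := sqrt_pos.2 hp
  rw [brk]
  congr 2
  rw [arsinh, sub_sub, ← log_mul hl0.ne' hs.ne', ← log_div (by positivity) (by positivity)]
  congr 1
  have : 1 + (1 / (l * sinh q)) ^ 2 = (√(1 + (l * sinh q) ^ 2) / (l * sinh q)) ^ 2 := by
    rw [div_pow, div_pow, sq_sqrt hp.le]
    field_simp
    try ring
  rw [this, sqrt_sq (by positivity)]
  field_simp

lemma brk_zero {l : ℝ} (hl0 : 0 < l) (hl1 : l < 1) :
    Tendsto (brk l) (𝓝[>] 0) (𝓝 (log l / 2)) := by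
  have h : ∀ q, 0 < q → (1 - l ^ 2) * sinh q / (√(1 + (l * sinh q) ^ 2) *
      (cosh q + √(1 + (l * sinh q) ^ 2))) * ((sinh q * log (1 + cosh q) - sinh q * log (sinh q)) / 2)
      + (log (1 + cosh q) - log (1 + √(1 + (l * sinh q) ^ 2)) + log l) / 2 = brk l q := by
    intro q hq
    have hs : 0 < sinh q := sinh_pos_iff.2 hq
    have hc := cosh_pos q
    have hp : 0 < 1 + (l * sinh q) ^ 2 := by positivity
    have hR := sqrt_pos.2 hp
    have hR2 : √(1 + (l * sinh q) ^ 2) ^ 2 = 1 + (l * sinh q) ^ 2 := sq_sqrt hp.le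
    have hC := cosh_sq q
    rw [brk, psiR]
    generalize √(1 + (l * sinh q) ^ 2) = R at *
    generalize log (1 + cosh q) = L1
    generalize log (sinh q) = L2
    generalize log (1 + R) = L3
    generalize log l = L4
    generalize sinh q = S at *
    generalize cosh q = C at *
    have : C / R = 1 + (1 - l ^ 2) * S * S / (R * (C + R)) := by
      field_simp
      linear_combination hC - hR2
    rw [this]
    field_simp
    ring
  have hcont : Continuous fun q => (1 - l ^ 2) * sinh q / (√(1 + (l * sinh q) ^ 2) *
      (cosh q + √(1 + (l * sinh q) ^ 2))) * ((sinh q * log (1 + cosh q) - sinh q * log (sinh q)) / 2)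
      + (log (1 + cosh q) - log (1 + √(1 + (l * sinh q) ^ 2)) + log l) / 2 := by
    have h1 : Continuous fun q => sinh q * log (sinh q) := continuous_mul_log.comp continuous_sinh
    have h2 : Continuous fun q => log (1 + cosh q) := by
      refine Continuous.log (by fun_prop) fun q => ?_
      have := cosh_pos q; positivity
    have h3 : Continuous fun q => log (1 + √(1 + (l * sinh q) ^ 2)) := by
      refine Continuous.log (by fun_prop) fun q => ?_
      positivity
    refine Continuous.add (Continuous.mul (Continuous.div (by fun_prop) (by fun_prop) ?_) ?_) ?_
    · intro q
      have := cosh_pos q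
      positivity
    · fun_prop
    · fun_prop
  have := (hcont.tendsto 0).mono_left (nhdsWithin_le_nhds (s := Ioi 0))
  have h0 : log l / 2 = (1 - l ^ 2) * sinh 0 / (√(1 + (l * sinh 0) ^ 2) *
      (cosh 0 + √(1 + (l * sinh 0) ^ 2))) * ((sinh 0 * log (1 + cosh 0) - sinh 0 * log (sinh 0)) / 2)
      + (log (1 + cosh 0) - log (1 + √(1 + (l * sinh 0) ^ 2)) + log l) / 2 := by
    simp
  rw [h0]
  refine this.congr' ?_
  filter_upwards [self_mem_nhdsWithin] with q hq using h q hq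

lemma M_int {l : ℝ} (hl0 : 0 < l) (hl1 : l < 1) :
    ∫⁻ q in Ioi (0:ℝ), psi q * ENNReal.ofReal (FF (l * sinh q)) =
      ENNReal.ofReal (l * (-log l) / (2 * (1 - l ^ 2))) := by
  have e : ∫⁻ q in Ioi (0:ℝ), psi q * ENNReal.ofReal (FF (l * sinh q)) =
      ∫⁻ q in Ioi (0:ℝ), ENNReal.ofReal (psiR q * FF (l * sinh q)) := by
    refine setLIntegral_congr_fun measurableSet_Ioi fun q hq => ?_
    rw [psi_eq hq, ENNReal.ofReal_mul (psiR_nonneg hq)]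
  have hl2 : 0 < 1 - l ^ 2 := by nlinarith
  rw [e, lint_ftc (fun q hq => brk_deriv hl0 hl1 hq) ?_ ((brk_zero hl0 hl1).const_mul _)
    ((brk_top hl0 hl1).const_mul _)]
  · congr 1
    field_simp
    ring
  · intro q hq
    have hs : 0 < sinh q := sinh_pos_iff.2 hq
    have := psiR_nonneg hq
    unfold FF
    positivity


noncomputable def ff : ℕ → ℝ → ENNReal
  | 0 => fun S => ENNReal.ofReal (FF S)
  | j + 1 => fun S => ∫⁻ τ in Ioi (0:ℝ), ff j (exp (-τ) * S)

lemma ff_succ (j : ℕ) (S : ℝ) : ff (j + 1) S = ∫⁻ τ in Ioi (0:ℝ), ff j (exp (-τ) * S) := rfl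

lemma ff_meas (j : ℕ) : Measurable (ff j) := by
  induction j with
  | zero =>
    have : Measurable FF := by unfold FF; fun_prop
    exact this.ennreal_ofReal
  | succ j ih =>
    have : Measurable (fun z : ℝ × ℝ => ff j (exp (-z.2) * z.1)) := by fun_prop
    exact this.lintegral_prod_right'

lemma ff_one {S : ℝ} (hS : 0 < S) : ff 1 S = ENNReal.ofReal (S / √(1 + S ^ 2)) := by
  rw [ff_succ]
  have hc : Continuous fun τ => -(exp (-τ) * S / √(1 + (exp (-τ) * S) ^ 2)) := by
    refine (Continuous.div (by fun_prop) (by fun_prop) ?_).neg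
    intro τ; positivity
  have h := lint_ftc (G := fun τ => -(exp (-τ) * S / √(1 + (exp (-τ) * S) ^ 2)))
    (g := fun τ => FF (exp (-τ) * S)) (a := 0) (l := 0) (l0 := -(S / √(1 + S ^ 2))) ?_ ?_ ?_ ?_
  · simp only [ff]
    rw [h]; congr 1; ring
  · intro τ _
    have hp : 0 < 1 + (exp (-τ) * S) ^ 2 := by positivity
    have hx := ((hasDerivAt_id τ).neg.exp).mul_const S
    have hR := ((hx.pow 2).const_add 1).sqrt (by simpa using hp.ne')
    have h := (hx.div hR (by simpa using (sqrt_pos.2 hp).ne')).neg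
    refine HasDerivAt.congr_deriv h ?_
    simp only [FF, Pi.pow_apply, Pi.neg_apply, id]
    have hR2 : √(1 + (exp (-τ) * S) ^ 2) ^ 2 = 1 + (exp (-τ) * S) ^ 2 := sq_sqrt hp.le
    have hR := sqrt_pos.2 hp
    generalize √(1 + (exp (-τ) * S) ^ 2) = R at *
    have he := exp_pos (-τ)
    generalize exp (-τ) = E at *
    field_simp
    push_cast
    rw [hR2]
    ring
  · intro τ _
    unfold FF; positivity
  · have := (hc.tendsto 0).mono_left (nhdsWithin_le_nhds (s := Ioi 0))
    simpa using this
  · have hx : Tendsto (fun τ : ℝ => exp (-τ) * S) atTop (𝓝 0) := by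
      simpa using (tendsto_exp_neg_atTop_nhds_zero).mul_const S
    have hc : Continuous fun x : ℝ => -(x / √(1 + x ^ 2)) := by
      refine (Continuous.div (by fun_prop) (by fun_prop) ?_).neg
      intro τ; positivity
    simpa [Function.comp_def] using (hc.tendsto 0).comp hx

noncomputable def mm (j : ℕ) (τ : ℝ) : ENNReal :=
  ∫⁻ q in Ioi (0:ℝ), psi q * ff j (exp (-τ) * sinh q)

lemma mm_succ (j : ℕ) (τ : ℝ) : mm (j + 1) τ = ∫⁻ σ in Ioi (0:ℝ), mm j (τ + σ) := by
  have e : ∀ q, psi q * ff (j + 1) (exp (-τ) * sinh q) =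
      ∫⁻ σ in Ioi (0:ℝ), psi q * ff j (exp (-(τ + σ)) * sinh q) := by
    intro q
    have hf := ff_meas j
    rw [ff_succ, ← lintegral_const_mul _ (by fun_prop)]
    refine lintegral_congr fun σ => ?_
    rw [← mul_assoc, ← exp_add]
    congr 4
    ring
  unfold mm
  simp_rw [e]
  refine lintegral_lintegral_swap ?_
  have hf := ff_meas j
  have hp := psi_meas
  refine Measurable.aemeasurable ?_
  unfold Function.uncurry
  fun_prop

lemma mm_term (m τ : ℝ) (hm : 0 < m) (hτ : 0 ≤ τ) (j : ℕ) :
    ∫⁻ σ in Ioi (0:ℝ), ENNReal.ofReal (((τ + σ) * exp (-m * (τ + σ)) / m ^ j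
      + j * exp (-m * (τ + σ)) / m ^ (j + 1)) / 2) =
    ENNReal.ofReal ((τ * exp (-m * τ) / m ^ (j + 1)
      + (j + 1 : ℕ) * exp (-m * τ) / m ^ (j + 1 + 1)) / 2) := by
  have h := lint_ftc (G := fun σ => -(((τ + σ) * exp (-m * (τ + σ)) / m ^ (j + 1)
      + (j + 1 : ℕ) * exp (-m * (τ + σ)) / m ^ (j + 1 + 1)) / 2))
    (g := fun σ => (((τ + σ) * exp (-m * (τ + σ)) / m ^ j
      + j * exp (-m * (τ + σ)) / m ^ (j + 1)) / 2)) (a := 0) (l := 0)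
    (l0 := -((τ * exp (-m * τ) / m ^ (j + 1)
      + (j + 1 : ℕ) * exp (-m * τ) / m ^ (j + 1 + 1)) / 2)) ?_ ?_ ?_ ?_
  · rw [h]; congr 1; ring
  · intro σ _
    have hx := (hasDerivAt_id σ).const_add τ
    have he := (hx.const_mul (-m)).exp
    have h := ((((hx.mul he).div_const (m ^ (j + 1))).add
      ((he.const_mul ((j + 1 : ℕ) : ℝ)).div_const (m ^ (j + 1 + 1)))).div_const 2).neg
    refine HasDerivAt.congr_deriv h ?_
    simp only [id]
    push_cast
    field_simp
    ring
  · intro σ hσ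
    have : 0 ≤ τ + σ := by linarith
    positivity
  · have hc : Continuous fun σ => -(((τ + σ) * exp (-m * (τ + σ)) / m ^ (j + 1)
      + (j + 1 : ℕ) * exp (-m * (τ + σ)) / m ^ (j + 1 + 1)) / 2) := by fun_prop
    have := (hc.tendsto 0).mono_left (nhdsWithin_le_nhds (s := Ioi 0))
    simpa using this
  · have hx : Tendsto (fun σ : ℝ => m * (τ + σ)) atTop atTop :=
      (tendsto_atTop_add_const_left _ τ tendsto_id).const_mul_atTop hm
    have h1 := (tendsto_pow_mul_exp_neg_atTop_nhds_zero 1).comp hx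
    have h0 := (tendsto_pow_mul_exp_neg_atTop_nhds_zero 0).comp hx
    have := (((h1.const_mul (1 / m / m ^ (j + 1))).add
      (h0.const_mul (((j + 1 : ℕ) : ℝ) / m ^ (j + 1 + 1)))).div_const 2).neg
    simp only [mul_zero, add_zero, zero_div, neg_zero] at this
    refine this.congr fun σ => ?_
    simp only [Function.comp, pow_one, pow_zero, neg_mul]
    field_simp

lemma mm_zero {τ : ℝ} (hτ : 0 < τ) : mm 0 τ =
    ∑' k : ℕ, ENNReal.ofReal ((τ * exp (-(2 * (k:ℝ) + 1) * τ)) / 2) := by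
  have hl1 : exp (-τ) < 1 := Real.exp_lt_one_iff.2 (by linarith)
  have hl0 := exp_pos (-τ)
  have h2 : exp (-τ) ^ 2 < 1 := by nlinarith
  have hs : HasSum (fun k : ℕ => (τ * exp (-(2 * (k:ℝ) + 1) * τ)) / 2)
      (exp (-τ) * (-log (exp (-τ))) / (2 * (1 - exp (-τ) ^ 2))) := by
    have h := (hasSum_geometric_of_lt_one (by positivity) h2).mul_left (τ * exp (-τ) / 2)
    have e : τ * exp (-τ) / 2 * (1 - exp (-τ) ^ 2)⁻¹ =
      exp (-τ) * (-log (exp (-τ))) / (2 * (1 - exp (-τ) ^ 2)) := by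
      rw [log_exp]
      have : 1 - exp (-τ) ^ 2 ≠ 0 := by linarith
      field_simp
    rw [← e]
    refine h.congr_fun fun k => ?_
    have : exp (-(2 * (k:ℝ) + 1) * τ) = exp (-τ) * (exp (-τ) ^ 2) ^ k := by
      rw [← pow_mul, ← exp_nat_mul, ← exp_add]
      congr 1; push_cast; ring
    rw [this]; ring
  have := M_int hl0 hl1
  unfold mm
  simp only [ff]
  rw [this, ← hs.tsum_eq, ENNReal.ofReal_tsum_of_nonneg _ hs.summable]
  intro k; positivity

lemma mm_eq (j : ℕ) : ∀ τ : ℝ, 0 ≤ τ → (0 < τ ∨ 1 ≤ j) → mm j τ =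
    ∑' k : ℕ, ENNReal.ofReal ((τ * exp (-(2 * (k:ℝ) + 1) * τ) / (2 * (k:ℝ) + 1) ^ j
      + j * exp (-(2 * (k:ℝ) + 1) * τ) / (2 * (k:ℝ) + 1) ^ (j + 1)) / 2) := by
  induction j with
  | zero =>
    intro τ _ h
    rw [mm_zero (by simpa using h)]
    simp
  | succ j ih =>
    intro τ hτ _
    rw [mm_succ]
    have : ∫⁻ σ in Ioi (0:ℝ), mm j (τ + σ) = ∫⁻ σ in Ioi (0:ℝ), ∑' k : ℕ, ENNReal.ofReal
      (((τ + σ) * exp (-(2 * (k:ℝ) + 1) * (τ + σ)) / (2 * (k:ℝ) + 1) ^ j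
      + j * exp (-(2 * (k:ℝ) + 1) * (τ + σ)) / (2 * (k:ℝ) + 1) ^ (j + 1)) / 2) := by
      refine setLIntegral_congr_fun measurableSet_Ioi fun σ hσ => ?_
      have : 0 < τ + σ := by have : 0 < σ := hσ; linarith
      exact ih _ this.le (Or.inl this)
    rw [this, lintegral_tsum]
    · refine tsum_congr fun k => ?_
      exact mm_term (2 * (k:ℝ) + 1) τ (by positivity) hτ j
    · intro k
      refine Measurable.aemeasurable ?_
      fun_prop


lemma idx_castSucc {d : ℕ} (g : Fin d → ℕ) (j : ℕ) (i : Fin d) :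
    idxSeq (Fin.snoc g j : Fin (d + 1) → ℕ) i.castSucc = idxSeq g i := by
  unfold idxSeq
  rw [Finset.sum_filter, Finset.sum_filter, Fin.sum_univ_castSucc]
  simp

lemma idx_last {d : ℕ} (g : Fin (d + 1) → ℕ) (j : ℕ) :
    idxSeq (Fin.snoc g j : Fin (d + 1 + 1) → ℕ) (Fin.last _) = idxSeq g (Fin.last _) + j := by
  unfold idxSeq
  rw [Finset.sum_filter, Finset.sum_filter, Fin.sum_univ_castSucc]
  simp [Fin.le_last]
  ring

lemma rep_snoc {d : ℕ} (g : Fin (d + 1) → ℕ) (j : ℕ) :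
    repCount (Fin.snoc g j : Fin (d + 1 + 1) → ℕ) = repCount g + if j = 0 then 1 else 0 := by
  unfold repCount
  rw [Finset.card_filter, Finset.card_filter, Fin.sum_univ_castSucc]
  simp

lemma idx_pos {d : ℕ} (g : Fin d → ℕ) (i : Fin d) : (0:ℝ) < 2 * (idxSeq g i : ℝ) - 1 := by
  have : 1 ≤ idxSeq g i := by unfold idxSeq; omega
  have : (1:ℝ) ≤ idxSeq g i := by exact_mod_cast this
  linarith

noncomputable def Wt {d : ℕ} (g : Fin (d + 1) → ℕ) : ℝ :=
  (1 / 2) ^ repCount g * (∏ i, 1 / (2 * (idxSeq g i : ℝ) - 1)) * (1 / (2 * (idxSeq g 0 : ℝ) - 1))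

lemma Wt_nonneg {d : ℕ} (g : Fin (d + 1) → ℕ) : 0 ≤ Wt g := by
  unfold Wt
  have h0 := idx_pos g 0
  have h1 : 0 ≤ ∏ i, 1 / (2 * (idxSeq g i : ℝ) - 1) :=
    Finset.prod_nonneg fun i _ => (one_div_pos.2 (idx_pos g i)).le
  exact mul_nonneg (mul_nonneg (pow_nonneg (by norm_num) _) h1) (one_div_pos.2 h0).le

lemma Wt_snoc {d : ℕ} (g : Fin (d + 1) → ℕ) (j : ℕ) :
    Wt (Fin.snoc g j : Fin (d + 1 + 1) → ℕ) = Wt g * (if j = 0 then 1 / 2 else 1)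
      / (2 * (idxSeq g (Fin.last _) : ℝ) - 1 + 2 * j) := by
  have h0 : idxSeq (Fin.snoc g j : Fin (d + 1 + 1) → ℕ) 0 = idxSeq g 0 := idx_castSucc g j 0
  unfold Wt
  rw [Fin.prod_univ_castSucc, rep_snoc, h0, idx_last]
  simp_rw [idx_castSucc]
  have : (2 * ((idxSeq g (Fin.last d) + j : ℕ) : ℝ) - 1) =
    (2 * (idxSeq g (Fin.last _) : ℝ) - 1 + 2 * j) := by push_cast; ring
  rw [this]
  by_cases hj : j = 0 <;> simp [hj, pow_succ] <;> ring

noncomputable def JJ (d : ℕ) (q : ℝ) : ENNReal :=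
  ∑' g : Fin (d + 1) → ℕ, ENNReal.ofReal (Wt g * exp (-(2 * (idxSeq g (Fin.last d) : ℝ) - 1) * q))

lemma JJ_meas (d : ℕ) : Measurable (JJ d) := by
  unfold JJ
  refine Measurable.tsum fun k => ?_
  fun_prop

lemma coth_sum {p : ℝ} (hp : 0 < p) :
    ∑' j : ℕ, ENNReal.ofReal ((if j = 0 then 1 / 2 else 1) * exp (-(2 * (j:ℝ)) * p)) =
      ENNReal.ofReal (1 / 2 * (cosh p / sinh p)) := by
  have hl1 : exp (-p) < 1 := Real.exp_lt_one_iff.2 (by linarith)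
  have hl0 := exp_pos (-p)
  have hs : 0 < sinh p := sinh_pos_iff.2 hp
  have h2 : exp (-p) ^ 2 < 1 := by nlinarith
  have h := hasSum_geometric_of_lt_one (by positivity) h2
  have h1 : HasSum (fun j : ℕ => if j = 0 then (1 / 2 : ℝ) else 0) (1 / 2) := by
    simpa using hasSum_ite_eq (0:ℕ) (1/2 : ℝ)
  have h3 := h.sub h1
  have e : (1 - exp (-p) ^ 2)⁻¹ - 1 / 2 = 1 / 2 * (cosh p / sinh p) := by
    have : 1 - exp (-p) ^ 2 ≠ 0 := by linarith
    field_simp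
    rw [cosh_eq, sinh_eq]
    have : exp (-p) * exp p = 1 := by rw [← exp_add]; simp
    generalize exp (-p) = x at *
    generalize exp p = y at *
    linear_combination (x) * this
  rw [e] at h3
  have h4 : HasSum (fun j : ℕ => (if j = 0 then 1 / 2 else 1) * exp (-(2 * (j:ℝ)) * p))
      (1 / 2 * (cosh p / sinh p)) := by
    refine h3.congr_fun fun j => ?_
    by_cases hj : j = 0
    · simp [hj]; norm_num
    · simp only [hj, if_false]
      rw [← pow_mul, ← exp_nat_mul]
      simp
  rw [← ENNReal.ofReal_tsum_of_nonneg _ h4.summable, h4.tsum_eq]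
  intro j
  split_ifs <;> positivity

lemma JJ_succ (d : ℕ) {q : ℝ} (hq : 0 ≤ q) : JJ (d + 1) q =
    ∫⁻ p in Ioi q, ENNReal.ofReal (1 / 2 * (cosh p / sinh p)) * JJ d p := by
  have e1 : ∀ p ∈ Ioi q, ENNReal.ofReal (1 / 2 * (cosh p / sinh p)) * JJ d p =
      ∑' g : Fin (d + 1) → ℕ, ∑' j : ℕ, ENNReal.ofReal ((Wt g * (if j = 0 then 1 / 2 else 1)) *
        exp (-(2 * (idxSeq g (Fin.last d) : ℝ) - 1 + 2 * j) * p)) := by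
    intro p hp
    have hp' : 0 < p := lt_of_le_of_lt hq hp
    rw [← coth_sum hp', JJ, ← ENNReal.tsum_mul_left]
    refine tsum_congr fun g => ?_
    rw [← ENNReal.tsum_mul_right]
    refine tsum_congr fun j => ?_
    rw [← ENNReal.ofReal_mul (by split_ifs <;> positivity)]
    congr 1
    have : exp (-(2 * (idxSeq g (Fin.last d) : ℝ) - 1 + 2 * j) * p) =
      exp (-(2 * (j:ℝ)) * p) * exp (-(2 * (idxSeq g (Fin.last d) : ℝ) - 1) * p) := by
      rw [← exp_add]; congr 1; ring
    rw [this]; ring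
  rw [setLIntegral_congr_fun measurableSet_Ioi e1, lintegral_tsum]
  · have e2 : ∀ g : Fin (d + 1) → ℕ, ∫⁻ p in Ioi q, ∑' j : ℕ, ENNReal.ofReal
        ((Wt g * (if j = 0 then 1 / 2 else 1)) *
        exp (-(2 * (idxSeq g (Fin.last d) : ℝ) - 1 + 2 * j) * p)) =
        ∑' j : ℕ, ENNReal.ofReal (Wt (Fin.snoc g j : Fin (d + 1 + 1) → ℕ) *
          exp (-(2 * (idxSeq (Fin.snoc g j : Fin (d + 1 + 1) → ℕ) (Fin.last (d + 1)) : ℝ) - 1) * q)) := by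
      intro g
      rw [lintegral_tsum]
      · refine tsum_congr fun j => ?_
        have hpos := idx_pos g (Fin.last d)
        rw [lint_exp _ _ _ ?_ (by positivity)]
        · congr 1
          rw [Wt_snoc, idx_last]
          have : (2 * ((idxSeq g (Fin.last d) + j : ℕ) : ℝ) - 1) =
            (2 * (idxSeq g (Fin.last _) : ℝ) - 1 + 2 * j) := by push_cast; ring
          rw [this]
          ring
        · have := Wt_nonneg g
          split_ifs <;> positivity
      · intro j
        refine Measurable.aemeasurable ?_
        fun_prop
    simp_rw [e2]
    rw [← ENNReal.tsum_prod, JJ]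
    rw [← (Fin.snocEquiv (fun _ : Fin (d + 1 + 1) => ℕ)).tsum_eq,
      ← (Equiv.prodComm (Fin (d + 1) → ℕ) ℕ).tsum_eq]
    rfl
  · intro g
    refine Measurable.aemeasurable ?_
    refine Measurable.tsum fun k => ?_
    fun_prop

lemma tsum_fin_one (f : (Fin 1 → ℕ) → ENNReal) : ∑' g, f g = ∑' k : ℕ, f (fun _ => k) :=
  ((Equiv.funUnique (Fin 1) ℕ).symm.tsum_eq f).symm

lemma idx_one (k : ℕ) (i : Fin 1) : 2 * (idxSeq (fun _ : Fin 1 => k) i : ℝ) - 1 = 2 * k + 1 := by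
  have : i = 0 := Subsingleton.elim _ _
  subst this
  simp [idxSeq]; ring

lemma rep_one (k : ℕ) : repCount (fun _ : Fin 1 => k) = 0 := by
  simp [repCount]

lemma JJ_zero (q : ℝ) : JJ 0 q = ∫⁻ p in Ioi q, psi p := by
  unfold JJ psi
  rw [tsum_fin_one, lintegral_tsum]
  · refine tsum_congr fun k => ?_
    rw [lint_exp _ _ _ (by positivity) (by positivity)]
    congr 1
    simp only [Wt, Finset.prod_const, Finset.card_univ, Fintype.card_fin, zero_add, pow_one, pow_zero, idx_one, rep_one]
    field_simp
  · intro j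
    refine Measurable.aemeasurable ?_
    fun_prop

lemma coth_meas : Measurable fun q : ℝ => ENNReal.ofReal (cosh q / sinh q) := by fun_prop

lemma JJ_step (d : ℕ) : ∀ j : ℕ,
    ∫⁻ q in Ioi (0:ℝ), JJ d q * (ENNReal.ofReal (cosh q / sinh q) * ff j (sinh q)) =
      ENNReal.ofReal (1 / 2) ^ d * mm (j + d + 1) 0 := by
  have key : ∀ (g : ℝ → ENNReal), Measurable g → ∀ j,
     ∫⁻ q in Ioi (0:ℝ), (∫⁻ p in Ioi q, g p) * (ENNReal.ofReal (cosh q / sinh q) * ff j (sinh q))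
       = ∫⁻ p in Ioi (0:ℝ), g p * ff (j + 1) (sinh p) := by
    intro g hg j
    have hf := ff_meas j
    have hc := coth_meas
    rw [tonelli (by fun_prop) hg]
    refine setLIntegral_congr_fun measurableSet_Ioi fun p hp => ?_
    rw [subst_lem (ff j) hp, ff_succ]
  induction d with
  | zero =>
    intro j
    simp_rw [JJ_zero]
    rw [key _ psi_meas]
    simp [mm]
  | succ d ih =>
    intro j
    have hJ := JJ_meas d
    have hc := coth_meas
    have hf := ff_meas (j + 1)
    have e : ∀ q ∈ Ioi (0:ℝ), JJ (d + 1) q * (ENNReal.ofReal (cosh q / sinh q) * ff j (sinh q)) =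
       (∫⁻ p in Ioi q, ENNReal.ofReal (1 / 2 * (cosh p / sinh p)) * JJ d p) *
        (ENNReal.ofReal (cosh q / sinh q) * ff j (sinh q)) := by
      intro q hq
      rw [JJ_succ d (le_of_lt hq)]
    rw [setLIntegral_congr_fun measurableSet_Ioi e, key _ (by fun_prop)]
    have e2 : ∀ p, ENNReal.ofReal (1 / 2 * (cosh p / sinh p)) * JJ d p * ff (j + 1) (sinh p) =
       ENNReal.ofReal (1 / 2) * (JJ d p * (ENNReal.ofReal (cosh p / sinh p) * ff (j + 1) (sinh p))) := by
      intro p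
      rw [ENNReal.ofReal_mul (by norm_num)]; ring
    simp_rw [e2]
    rw [lintegral_const_mul _ (by fun_prop), ih (j + 1)]
    rw [pow_succ', mul_assoc]
    congr 3
    ring

lemma JJ_int (d : ℕ) : ∫⁻ q in Ioi (0:ℝ), JJ d q = ENNReal.ofReal (1 / 2) ^ d * mm (d + 2) 0 := by
  have := JJ_step d 1
  rw [show 1 + d + 1 = d + 2 by ring] at this
  rw [← this]
  refine setLIntegral_congr_fun measurableSet_Ioi fun q hq => ?_
  have hs : 0 < sinh q := sinh_pos_iff.2 hq
  have hc := cosh_pos q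
  rw [ff_one hs, ← ENNReal.ofReal_mul (by positivity)]
  have : √(1 + sinh q ^ 2) = cosh q := by
    rw [add_comm, ← cosh_sq, sqrt_sq hc.le]
  rw [this]
  have : cosh q / sinh q * (sinh q / cosh q) = 1 := by field_simp
  rw [this]; simp

lemma JJ_int' (d : ℕ) : ∫⁻ q in Ioi (0:ℝ), JJ d q =
    ∑' g : Fin (d + 1) → ℕ, ENNReal.ofReal (Wt g / (2 * (idxSeq g (Fin.last d) : ℝ) - 1)) := by
  unfold JJ
  rw [lintegral_tsum]
  · refine tsum_congr fun g => ?_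
    rw [lint_exp _ _ _ (Wt_nonneg g) (idx_pos g _)]
    simp
  · intro j
    refine Measurable.aemeasurable ?_
    fun_prop

lemma tInterp_one (n : ℕ) : tInterp (1 / 2) (fun _ : Fin 1 => n + 4) =
    ∑' k : ℕ, 1 / (2 * (k:ℝ) + 1) ^ (n + 4) := by
  unfold tInterp
  rw [← (Equiv.funUnique (Fin 1) ℕ).symm.tsum_eq]
  refine tsum_congr fun k => ?_
  have : (Equiv.funUnique (Fin 1) ℕ).symm k = fun _ => k := rfl
  rw [this]
  simp only [Finset.univ_unique, Finset.prod_singleton, idx_one, rep_one]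
  simp

lemma term_eq (n : ℕ) (g : Fin (n + 1 + 1) → ℕ) :
    (1 / 2 : ℝ) ^ repCount g * ∏ i, 1 / (2 * (idxSeq g i : ℝ) - 1) ^
      ((Fin.cons 2 (Fin.snoc (fun _ : Fin n => 1) 2) : Fin (n + 1 + 1) → ℕ) i) =
    Wt g / (2 * (idxSeq g (Fin.last (n + 1)) : ℝ) - 1) := by
  unfold Wt
  rw [Fin.prod_univ_succ, Fin.prod_univ_castSucc, Fin.prod_univ_succ (n := n + 1),
    Fin.prod_univ_castSucc (n := n)]
  simp only [Fin.cons_zero, Fin.cons_succ, Fin.snoc_castSucc, Fin.snoc_last, pow_one]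
  rw [show Fin.last (n + 1) = (Fin.last n).succ from rfl]
  have h0 := idx_pos g 0
  have h1 := idx_pos g (Fin.last n).succ
  field_simp

lemma main1 (n : ℕ) :
    tInterp (1/2) (Fin.cons 2 (Fin.snoc (fun _ : Fin n => 1) 2)) =
      ((n : ℝ) + 3) / 2 ^ (n + 2) * tInterp (1/2) (fun _ : Fin 1 => n + 4) := by
  have h1 : tInterp (1/2) (Fin.cons 2 (Fin.snoc (fun _ : Fin n => 1) 2)) =
      (∑' g : Fin (n + 1 + 1) → ℕ, ENNReal.ofReal
        (Wt g / (2 * (idxSeq g (Fin.last (n + 1)) : ℝ) - 1))).toReal := by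
    rw [ENNReal.tsum_toReal_eq (fun _ => ENNReal.ofReal_ne_top)]
    unfold tInterp
    refine tsum_congr fun g => ?_
    rw [ENNReal.toReal_ofReal (div_nonneg (Wt_nonneg g) (idx_pos g _).le), ← term_eq]
  rw [h1, ← JJ_int', JJ_int, mm_eq _ 0 le_rfl (Or.inr (by omega)), ENNReal.toReal_mul,
    ENNReal.tsum_toReal_eq (fun _ => ENNReal.ofReal_ne_top), tInterp_one, ENNReal.toReal_pow,
    ENNReal.toReal_ofReal (by norm_num), ← tsum_mul_left, ← tsum_mul_left]
  refine tsum_congr fun k => ?_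
  rw [ENNReal.toReal_ofReal (by positivity)]
  simp only [zero_mul, zero_div, zero_add, mul_zero, exp_zero, mul_one]
  push_cast
  rw [one_div_pow]
  field_simp
  ring

lemma zeta_odd (s : ℕ) (hs : 1 < s) :
    (((∑' k : ℕ, 1 / (2 * (k:ℝ) + 1) ^ s : ℝ)) : ℂ) =
      (1 - ((2 : ℂ) ^ s)⁻¹) * riemannZeta s := by
  have hsum : Summable fun n : ℕ => 1 / (n : ℝ) ^ s := Real.summable_one_div_nat_pow.2 hs
  have hz : riemannZeta s = ((∑' n : ℕ, 1 / (n : ℝ) ^ s : ℝ) : ℂ) := by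
    rw [zeta_nat_eq_tsum_of_gt_one hs]; push_cast; rfl
  have he : Summable fun k : ℕ => 1 / ((2 * k : ℕ) : ℝ) ^ s :=
    hsum.comp_injective (i := fun k => 2 * k) (fun a b h => by simpa using h)
  have ho : Summable fun k : ℕ => 1 / ((2 * k + 1 : ℕ) : ℝ) ^ s :=
    hsum.comp_injective (i := fun k => 2 * k + 1) (fun a b h => by simpa using h)
  have h := tsum_even_add_odd (f := fun n : ℕ => 1 / (n : ℝ) ^ s) he ho
  have h2 : ∑' k : ℕ, 1 / ((2 * k : ℕ) : ℝ) ^ s = ((2:ℝ) ^ s)⁻¹ * ∑' n : ℕ, 1 / (n : ℝ) ^ s := by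
    rw [← tsum_mul_left]
    refine tsum_congr fun k => ?_
    push_cast
    rw [mul_pow, one_div, mul_inv, one_div]
  have h3 : ∑' k : ℕ, 1 / (2 * (k:ℝ) + 1) ^ s = (1 - ((2 : ℝ) ^ s)⁻¹) * ∑' n : ℕ, 1 / (n : ℝ) ^ s := by
    simp only [h2] at h
    push_cast at h
    linarith
  rw [hz, h3]
  push_cast
  rfl

end THalf

/-- `t^{1/2}(2, {1}^n, 2) = ((n+3)/2^{n+2}) t(n+4)
= ((n+3)/2^{n+2}) (1 − 2^{−(n+4)}) ζ(n+4)`, where `t(s) = t^r(s)` in depth one. -/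
theorem tHalf_2_ones_2 (n : ℕ) :
    tInterp (1/2) (Fin.cons 2 (Fin.snoc (fun _ : Fin n => 1) 2)) =
      ((n : ℝ) + 3) / 2 ^ (n + 2) * tInterp (1/2) (fun _ : Fin 1 => n + 4) ∧
    ((tInterp (1/2) (Fin.cons 2 (Fin.snoc (fun _ : Fin n => 1) 2)) : ℝ) : ℂ) =
      ((n : ℂ) + 3) / 2 ^ (n + 2) * (1 - ((2 : ℂ) ^ (n + 4))⁻¹) *
        riemannZeta (n + 4) := by
  refine ⟨THalf.main1 n, ?_⟩
  rw [THalf.main1 n, THalf.tInterp_one, Complex.ofReal_mul, THalf.zeta_odd (n + 4) (by omega)]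
  push_cast
  ring
end

section
/- Let x, y ∈ ℂ be such that x ≠ ±y, x ≠ 0, y ≠ 0, neither x−y+1/2 nor y−x+1/2 is a nonpositive integer, and none of 1+x, 1+y, 1+2x, 1+2y is a nonpositive integer (so that both sides are defined). Then ∑_{k≥0} 2·cos(π(x−y))·Γ(k+x−y+1/2)·Γ(k−x+y+1/2) / ( (2k+1)·Γ(k−x−y+3/2)·Γ(k+x+y+3/2) ) = sin(πx)sin(πy)/(2xy(x+y)) + (cos(π(x−y))/(x²−y²))·(ψ(1+x) − ψ(1+y)) − (2cos(πx)cos(πy)/(x²−y²))·(ψ(1+2x) − ψ(1+2y)). -/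
/-- The digamma function `ψ(z) = Γ′(z)/Γ(z)`. -/
noncomputable def digammaC (z : ℂ) : ℂ := deriv Complex.Gamma z / Complex.Gamma z

namespace GenFun
open Complex Filter Topology

lemma gamma_prod (z : ℂ) (hz : ∀ k : ℕ, z ≠ -k) (n : ℕ) :
    Gamma (z + n) = Gamma z * ∏ j ∈ Finset.range n, (z + j) := by
  induction n with
  | zero => simp
  | succ n ih =>
    have hzn : z + n ≠ 0 := fun h => hz n (by linear_combination h)
    rw [Finset.prod_range_succ, show z + ((n+1:ℕ):ℂ) = (z + n) + 1 by push_cast; ring,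
      Gamma_add_one _ hzn, ih]
    ring

lemma gas0 (z : ℂ) (hz : 0 < z.re) :
    Tendsto (fun n : ℕ => Gamma (z + n) / ((n:ℂ) ^ (z - 1) * n.factorial)) atTop (𝓝 1) := by
  have hz' : ∀ k : ℕ, z ≠ -k := by
    intro k h
    have := congrArg re h
    simp at this
    have h2 : (0:ℝ) ≤ k := Nat.cast_nonneg k
    linarith
  have hG := Complex.Gamma_ne_zero hz'
  have h1 : Tendsto (fun n : ℕ => Gamma z / GammaSeq z n * ((n:ℂ) / (z + n))) atTop (𝓝 1) := by
    have ha := (tendsto_const_nhds (x := Gamma z)).div (GammaSeq_tendsto_Gamma z) hG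
    rw [div_self hG] at ha
    have hb : Tendsto (fun n : ℕ => (n:ℂ) / (z + n)) atTop (𝓝 1) := by
      simpa [add_comm] using tendsto_natCast_div_add_atTop (𝕜 := ℂ) z
    simpa using ha.mul hb
  refine h1.congr' ?_
  filter_upwards [eventually_ge_atTop 1] with n hn
  have hn0 : (n:ℂ) ≠ 0 := by exact_mod_cast (by omega : n ≠ 0)
  have hzn : z + n ≠ 0 := fun h => hz' n (by linear_combination h)
  have h2 : Gamma (z + n) = Gamma z * ∏ j ∈ Finset.range n, (z + j) := by
    exact gamma_prod z hz' n
  have hp : ∏ j ∈ Finset.range n, (z + j) ≠ 0 :=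
    Finset.prod_ne_zero_iff.2 fun j _ h => hz' j (by linear_combination h)
  have hc : (n:ℂ) ^ z = (n:ℂ) ^ (z - 1) * n := by
    rw [cpow_sub _ _ hn0, cpow_one]; field_simp
  have hc0 : (n:ℂ) ^ (z - 1) ≠ 0 := by simp [cpow_eq_zero_iff, hn0]
  have hf : (n.factorial : ℂ) ≠ 0 := by exact_mod_cast n.factorial_ne_zero
  rw [h2, GammaSeq, Finset.prod_range_succ, hc]
  field_simp

lemma gas_down (z : ℂ)
    (h : Tendsto (fun n : ℕ => Gamma (z + 1 + n) / ((n:ℂ) ^ (z + 1 - 1) * n.factorial)) atTop (𝓝 1)) :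
    Tendsto (fun n : ℕ => Gamma (z + n) / ((n:ℂ) ^ (z - 1) * n.factorial)) atTop (𝓝 1) := by
  have hb : Tendsto (fun n : ℕ => (n:ℂ) / (z + n)) atTop (𝓝 1) := by
    simpa [add_comm] using tendsto_natCast_div_add_atTop (𝕜 := ℂ) z
  have h2 := h.mul hb
  rw [mul_one] at h2
  refine h2.congr' ?_
  filter_upwards [eventually_gt_atTop ⌈‖z‖⌉₊] with n hn
  have hn1 : ‖z‖ < n := Nat.lt_of_ceil_lt hn
  have hn0 : (n:ℂ) ≠ 0 := by exact_mod_cast (by omega : n ≠ 0)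
  have hzn : z + n ≠ 0 := by
    intro h
    have : z = -n := by linear_combination h
    rw [this] at hn1
    simp at hn1
  have hc : (n:ℂ) ^ z = (n:ℂ) ^ (z - 1) * n := by
    rw [cpow_sub _ _ hn0, cpow_one]; field_simp
  have hc0 : (n:ℂ) ^ (z - 1) ≠ 0 := by simp [cpow_eq_zero_iff, hn0]
  have hf : (n.factorial : ℂ) ≠ 0 := by exact_mod_cast n.factorial_ne_zero
  rw [show z + 1 + (n:ℂ) = (z + n) + 1 by ring, Gamma_add_one _ hzn, add_sub_cancel_right, hc]
  field_simp

lemma gas (z : ℂ) :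
    Tendsto (fun n : ℕ => Gamma (z + n) / ((n:ℂ) ^ (z - 1) * n.factorial)) atTop (𝓝 1) := by
  have key : ∀ m : ℕ, ∀ z : ℂ, 0 < z.re + m →
      Tendsto (fun n : ℕ => Gamma (z + n) / ((n:ℂ) ^ (z - 1) * n.factorial)) atTop (𝓝 1) := by
    intro m
    induction m with
    | zero => intro z hz; exact gas0 z (by simpa using hz)
    | succ m ih =>
      intro z hz
      apply gas_down
      apply ih
      push_cast at hz
      simp
      linarith
  obtain ⟨m, hm⟩ := exists_nat_gt (-z.re)
  exact key m z (by linarith)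

lemma ratio2 (p q r s : ℂ) (d : ℕ) (h : r + s = p + q + d) :
    Tendsto (fun n : ℕ => (n:ℂ) ^ d * (Gamma (p + n) * Gamma (q + n) /
      (Gamma (r + n) * Gamma (s + n)))) atTop (𝓝 1) := by
  have h1 := ((gas p).mul (gas q)).div ((gas r).mul (gas s)) (by simp)
  simp only [mul_one, div_one] at h1
  refine h1.congr' ?_
  filter_upwards [eventually_ge_atTop 1] with n hn
  have hn0 : (n:ℂ) ≠ 0 := by exact_mod_cast (by omega : n ≠ 0)
  have hf : (n.factorial : ℂ) ≠ 0 := by exact_mod_cast n.factorial_ne_zero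
  have e : (n:ℂ) ^ (r - 1) * (n:ℂ) ^ (s - 1) = (n:ℂ) ^ (p - 1) * (n:ℂ) ^ (q - 1) * (n:ℂ) ^ d := by
    rw [← cpow_natCast, ← cpow_add _ _ hn0, ← cpow_add _ _ hn0, ← cpow_add _ _ hn0]
    congr 1
    linear_combination h
  have hp : (n:ℂ) ^ (p - 1) ≠ 0 := by simp [cpow_eq_zero_iff, hn0]
  have hq : (n:ℂ) ^ (q - 1) ≠ 0 := by simp [cpow_eq_zero_iff, hn0]
  have e1 : Gamma (p + n) / ((n:ℂ) ^ (p - 1) * n.factorial) * (Gamma (q + n) / ((n:ℂ) ^ (q - 1) * n.factorial)) = (Gamma (p + n) * Gamma (q + n)) / ((n:ℂ) ^ (p - 1) * (n:ℂ) ^ (q - 1) * (n.factorial * n.factorial)) := by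
    rw [div_mul_div_comm]; congr 1; ring
  have e2 : Gamma (r + n) / ((n:ℂ) ^ (r - 1) * n.factorial) * (Gamma (s + n) / ((n:ℂ) ^ (s - 1) * n.factorial)) = (Gamma (r + n) * Gamma (s + n)) / ((n:ℂ) ^ (p - 1) * (n:ℂ) ^ (q - 1) * (n:ℂ) ^ d * (n.factorial * n.factorial)) := by
    rw [div_mul_div_comm, ← e]; congr 1; ring
  simp only [Pi.div_apply, e1, e2]
  rw [div_div_div_eq, mul_comm (_ * (_ * _) : ℂ) (Gamma (r + n) * _), mul_div_assoc', ]
  by_cases hz : Gamma (r + n) * Gamma (s + n) = 0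
  · simp [hz]
  · field_simp


lemma gammaSeq_norm_le (s : ℂ) (hs : 0 < s.re) (n : ℕ) (hn : n ≠ 0) :
    ‖GammaSeq s n‖ ≤ Real.Gamma s.re := by
  rw [GammaSeq_eq_approx_Gamma_integral hs hn, Real.Gamma_eq_integral hs]
  have hn0 : (0:ℝ) ≤ n := Nat.cast_nonneg n
  have hnp : (0:ℝ) < n := by exact_mod_cast Nat.pos_of_ne_zero hn
  have hI := Real.GammaIntegral_convergent hs
  have hI2 : MeasureTheory.IntegrableOn (fun x : ℝ => Real.exp (-x) * x ^ (s.re - 1)) (Set.Ioc 0 (n:ℝ)) :=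
    hI.mono_set Set.Ioc_subset_Ioi_self
  refine (intervalIntegral.norm_integral_le_of_norm_le hn0
    (g := fun x : ℝ => Real.exp (-x) * x ^ (s.re - 1)) ?_ ?_).trans ?_
  · refine Eventually.of_forall fun x hx => ?_
    rw [norm_mul, norm_cpow_eq_rpow_re_of_pos hx.1, Complex.norm_real]
    have h1 : 0 ≤ 1 - x / n := by
      rw [sub_nonneg, div_le_one hnp]; exact hx.2
    rw [Real.norm_of_nonneg (pow_nonneg h1 n)]
    have := Real.one_sub_div_pow_le_exp_neg hx.2
    simp only [sub_re, one_re]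
    have h2 : (0:ℝ) ≤ x ^ (s.re - 1) := Real.rpow_nonneg hx.1.le _
    gcongr
  · rw [intervalIntegrable_iff_integrableOn_Ioc_of_le hn0]
    exact hI2
  · rw [intervalIntegral.integral_of_le hn0]
    refine MeasureTheory.setIntegral_mono_set hI ?_ (Set.Ioc_subset_Ioi_self.eventuallyLE)
    filter_upwards [MeasureTheory.ae_restrict_mem measurableSet_Ioi] with x hx
    have : (0:ℝ) < x := hx
    simp only [Pi.zero_apply]
    positivity

lemma gammaSeq_hasDeriv (s : ℂ) (hs : 0 < s.re) (n : ℕ) (hn : n ≠ 0) :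
    HasDerivAt (fun z => GammaSeq z n)
      (GammaSeq s n * (Complex.log n - ∑ j ∈ Finset.range (n + 1), (s + j)⁻¹)) s := by
  have hn0 : (n:ℂ) ≠ 0 := by exact_mod_cast hn
  have hne : ∀ j : ℕ, s + j ≠ 0 := by
    intro j h
    have := congrArg re h
    simp at this
    have h2 : (0:ℝ) ≤ j := Nat.cast_nonneg j
    linarith
  have hprod : ∀ m : ℕ, HasDerivAt (fun z : ℂ => ∏ j ∈ Finset.range m, (z + j))
      ((∏ j ∈ Finset.range m, (s + j)) * ∑ j ∈ Finset.range m, (s + j)⁻¹) s := by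
    intro m
    induction m with
    | zero => simpa using hasDerivAt_const s (1:ℂ)
    | succ m ih =>
      have h := ih.mul ((hasDerivAt_id s).add_const (m:ℂ))
      simp only [Finset.prod_range_succ, Finset.sum_range_succ]
      refine h.congr_deriv ?_
      have := hne m
      simp only [id]
      field_simp
  have hpow : HasDerivAt (fun z : ℂ => (n:ℂ) ^ z * n.factorial) ((n:ℂ) ^ s * Complex.log n * n.factorial) s := by
    have := ((hasDerivAt_id s).const_cpow (c := (n:ℂ)) (Or.inl hn0)).mul_const (n.factorial : ℂ)
    simpa using this
  have hp : ∏ j ∈ Finset.range (n+1), (s + j) ≠ 0 :=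
    Finset.prod_ne_zero_iff.2 fun j _ => hne j
  have h := hpow.div (hprod (n+1)) hp
  unfold GammaSeq
  refine h.congr_deriv ?_
  field_simp

lemma re_circle (s : ℂ) (R : ℝ) (_hR : 0 < R) (z : ℂ) (hz : z ∈ Metric.closedBall s R) :
    s.re - R ≤ z.re ∧ z.re ≤ s.re + R := by
  have h1 := Complex.abs_re_le_norm (z - s)
  rw [Metric.mem_closedBall, dist_eq_norm] at hz
  have := abs_le.1 (h1.trans hz)
  simp at this
  constructor <;> linarith [this.1, this.2]

lemma gammaSeq_deriv_tendsto (s : ℂ) (hs : 0 < s.re) :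
    Tendsto (fun n : ℕ => deriv (fun z => GammaSeq z n) s) atTop (𝓝 (deriv Gamma s)) := by
  set R := s.re / 2 with hRdef
  have hR : 0 < R := by positivity
  set U : Set ℂ := {z | 0 < z.re}
  have hU : IsOpen U := isOpen_lt continuous_const continuous_re
  have hball : Metric.closedBall s R ⊆ U := by
    intro z hz
    have := (re_circle s R hR z hz).1
    show 0 < z.re
    linarith
  have hs' : s ∈ Metric.ball s R := Metric.mem_ball_self hR
  have hpole : ∀ z ∈ U, ∀ m : ℕ, z ≠ -m := by
    intro z hz m h
    have hz' : 0 < z.re := hz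
    have := congrArg re h
    simp at this
    have h2 : (0:ℝ) ≤ m := Nat.cast_nonneg m
    linarith
  have hdG : DifferentiableOn ℂ Gamma U := fun z hz =>
    (differentiableAt_Gamma z (hpole z hz)).differentiableWithinAt
  rw [← two_pi_I_inv_smul_circleIntegral_sub_sq_inv_smul_of_differentiable hU hball hdG hs']
  have hdS : ∀ n : ℕ, n ≠ 0 → DifferentiableOn ℂ (fun z => GammaSeq z n) U := fun n hn z hz =>
    (gammaSeq_hasDeriv z hz n hn).differentiableAt.differentiableWithinAt
  obtain ⟨M, hM⟩ : ∃ M, ∀ t ∈ Set.Icc (s.re - R) (s.re + R), ‖Real.Gamma t‖ ≤ M := by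
    refine isCompact_Icc.exists_bound_of_continuousOn ?_
    refine Real.differentiableOn_Gamma_Ioi.continuousOn.mono ?_
    intro t ht
    have := ht.1
    show 0 < t
    linarith
  have hmain : Tendsto (fun n : ℕ => (2 * (Real.pi:ℂ) * I)⁻¹ • ∮ (z : ℂ) in C(s, R), ((z - s) ^ 2)⁻¹ • GammaSeq z n) atTop
      (𝓝 ((2 * (Real.pi:ℂ) * I)⁻¹ • ∮ (z : ℂ) in C(s, R), ((z - s) ^ 2)⁻¹ • Gamma z)) := by
    apply Tendsto.const_smul
    unfold circleIntegral
    have hmem : ∀ θ : ℝ, circleMap s R θ ∈ Metric.closedBall s R := fun θ =>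
      circleMap_mem_closedBall s hR.le θ
    refine intervalIntegral.tendsto_integral_filter_of_dominated_convergence
      (fun _ => R * (((R:ℝ) ^ 2)⁻¹ * M)) ?_ ?_ ?_ ?_
    · filter_upwards [eventually_ge_atTop 1] with n hn
      refine Continuous.aestronglyMeasurable ?_
      have hc : Continuous fun θ : ℝ => GammaSeq (circleMap s R θ) n :=
        (hdS n (by omega)).continuousOn.comp_continuous (continuous_circleMap s R)
          (fun θ => hball (hmem θ))
      have hd : Continuous fun θ : ℝ => ((circleMap s R θ - s) ^ 2)⁻¹ := by
        refine Continuous.inv₀ (((continuous_circleMap s R).sub continuous_const).pow 2) ?_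
        intro θ
        simp [circleMap, hR.ne']
      simp only [deriv_circleMap]
      exact ((continuous_circleMap 0 R).mul continuous_const).smul (hd.smul hc)
    · filter_upwards [eventually_ge_atTop 1] with n hn
      refine Eventually.of_forall fun θ _ => ?_
      have h1 := gammaSeq_norm_le (circleMap s R θ) (hball (hmem θ)) n (by omega)
      have h2 := hM (circleMap s R θ).re (re_circle s R hR _ (hmem θ))
      have h3 : ‖GammaSeq (circleMap s R θ) n‖ ≤ M := h1.trans ((le_abs_self _).trans h2)
      simp only [deriv_circleMap, norm_smul, norm_mul, norm_I, mul_one, norm_inv, norm_pow,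
        circleMap_sub_center, norm_circleMap_zero, abs_of_pos hR]
      gcongr
    · exact intervalIntegrable_const
    · refine Eventually.of_forall fun θ _ => ?_
      exact ((GammaSeq_tendsto_Gamma _).const_smul _).const_smul _
  refine hmain.congr' ?_
  filter_upwards [eventually_ge_atTop 1] with n hn
  exact two_pi_I_inv_smul_circleIntegral_sub_sq_inv_smul_of_differentiable hU hball
    (hdS n (by omega)) hs'

lemma digamma_lim (s : ℂ) (hs : 0 < s.re) :
    Tendsto (fun n : ℕ => Complex.log n - ∑ j ∈ Finset.range (n + 1), (s + j)⁻¹) atTop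
      (𝓝 (digamma s)) := by
  have hG := Complex.Gamma_ne_zero_of_re_pos hs
  have h := (gammaSeq_deriv_tendsto s hs).div (GammaSeq_tendsto_Gamma s) hG
  rw [digamma_def, logDeriv_apply]
  refine h.congr' ?_
  have hne : ∀ᶠ n in atTop, GammaSeq s n ≠ 0 := (GammaSeq_tendsto_Gamma s).eventually_ne hG
  filter_upwards [eventually_ge_atTop 1, hne] with n hn hn2
  simp only [Pi.div_apply]
  rw [(gammaSeq_hasDeriv s hs n (by omega)).deriv]
  field_simp

lemma digamma_add_nat (s : ℂ) (hs : ∀ m : ℕ, s ≠ -m) (n : ℕ) :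
    digamma (s + n) = digamma s + ∑ j ∈ Finset.range n, (s + j)⁻¹ := by
  induction n with
  | zero => simp
  | succ n ih =>
    rw [show s + ((n+1:ℕ):ℂ) = (s + n) + 1 by push_cast; ring, digamma_apply_add_one, ih,
      Finset.sum_range_succ]
    · ring
    · intro m h
      exact hs (n+m) (by push_cast; linear_combination h)

lemma digamma_diff0 (z w : ℂ) (hz : 0 < z.re) (hw : 0 < w.re) :
    Tendsto (fun n : ℕ => digamma (z + n) - digamma (w + n)) atTop (𝓝 0) := by
  have hp : ∀ s : ℂ, 0 < s.re → ∀ m : ℕ, s ≠ -m := by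
    intro s hs m h
    have := congrArg re h
    simp at this
    have h2 : (0:ℝ) ≤ m := Nat.cast_nonneg m
    linarith
  rw [← tendsto_add_atTop_iff_nat 1]
  have h := (digamma_lim w hw).sub (digamma_lim z hz)
  have h2 := h.const_add (digamma z - digamma w)
  simp only [sub_add_sub_cancel, sub_self] at h2
  refine h2.congr fun n => ?_
  rw [digamma_add_nat z (hp z hz), digamma_add_nat w (hp w hw)]
  ring

lemma digamma_diff (z w : ℂ) :
    Tendsto (fun n : ℕ => digamma (z + n) - digamma (w + n)) atTop (𝓝 0) := by
  obtain ⟨m1, hm1⟩ := exists_nat_gt (-z.re)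
  obtain ⟨m2, hm2⟩ := exists_nat_gt (-w.re)
  rw [← tendsto_add_atTop_iff_nat (m1 + m2)]
  have h1 : (0:ℝ) ≤ m1 := Nat.cast_nonneg m1
  have h2 : (0:ℝ) ≤ m2 := Nat.cast_nonneg m2
  have := digamma_diff0 (z + (m1 + m2 : ℕ)) (w + (m1 + m2 : ℕ)) (by simp; linarith) (by simp; linarith)
  refine this.congr fun n => ?_
  push_cast
  ring_nf

noncomputable def Pk (a : ℂ) (k : ℕ) : ℂ := Gamma (1/2 + a + k) * Gamma (1/2 - a + k)
noncomputable def Qk (b : ℂ) (k : ℕ) : ℂ := (Gamma (3/2 - b + k) * Gamma (3/2 + b + k))⁻¹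
noncomputable def Wk (b : ℂ) (k : ℕ) : ℂ := (Gamma (3/2 - b + k) * Gamma (5/2 + b + k))⁻¹
noncomputable def Vk (b : ℂ) (k : ℕ) : ℂ := (Gamma (1/2 - b + k) * Gamma (3/2 + b + k))⁻¹
noncomputable def tk (a b : ℂ) (k : ℕ) : ℂ := Pk a k * Qk b k / (k + 1/2)

lemma Qk_W (b : ℂ) (k : ℕ) : Qk b k = (3/2 + b + k) * Wk b k := by
  have h := one_div_Gamma_eq_self_mul_one_div_Gamma_add_one (3/2 + b + k)
  rw [show 3/2 + b + (k:ℂ) + 1 = 5/2 + b + k by ring] at h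
  rw [Qk, Wk, mul_inv, h, mul_inv]; ring

lemma Qk_W' (b : ℂ) (k : ℕ) : Qk (b + 1) k = (1/2 - b + k) * Wk b k := by
  have h := one_div_Gamma_eq_self_mul_one_div_Gamma_add_one (1/2 - b + k)
  rw [show 1/2 - b + (k:ℂ) + 1 = 3/2 - b + k by ring] at h
  rw [Qk, Wk, mul_inv, show 3/2 - (b + 1) + (k:ℂ) = 1/2 - b + k by ring, h, mul_inv,
    show 3/2 + (b + 1) + (k:ℂ) = 5/2 + b + k by ring]; ring

lemma Vk_W (b : ℂ) (k : ℕ) : Vk b k = (1/2 - b + k) * (3/2 + b + k) * Wk b k := by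
  have h := one_div_Gamma_eq_self_mul_one_div_Gamma_add_one (1/2 - b + k)
  rw [show 1/2 - b + (k:ℂ) + 1 = 3/2 - b + k by ring] at h
  have h' := one_div_Gamma_eq_self_mul_one_div_Gamma_add_one (3/2 + b + k)
  rw [show 3/2 + b + (k:ℂ) + 1 = 5/2 + b + k by ring] at h'
  rw [Vk, Wk, mul_inv, h, h', mul_inv]; ring

lemma Vk_succ (b : ℂ) (k : ℕ) : Vk b (k + 1) = Wk b k := by
  rw [Vk, Wk]; push_cast
  rw [show 1/2 - b + ((k:ℂ) + 1) = 3/2 - b + k by ring,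
    show 3/2 + b + ((k:ℂ) + 1) = 5/2 + b + k by ring]

lemma Pk_succ (a : ℂ) (hA : ∀ n : ℕ, 1/2 + a + n ≠ 0) (hB : ∀ n : ℕ, 1/2 - a + n ≠ 0) (k : ℕ) :
    Pk a (k + 1) = ((k + 1/2) ^ 2 - a ^ 2) * Pk a k := by
  rw [Pk, Pk]; push_cast
  rw [show 1/2 + a + ((k:ℂ) + 1) = (1/2 + a + k) + 1 by ring,
    show 1/2 - a + ((k:ℂ) + 1) = (1/2 - a + k) + 1 by ring, Gamma_add_one _ (hA k),
    Gamma_add_one _ (hB k)]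
  ring

lemma PQ_lim (a b : ℂ) : Tendsto (fun k : ℕ => (k:ℂ) ^ 2 * (Pk a k * Qk b k)) atTop (𝓝 1) := by
  have := ratio2 (1/2 + a) (1/2 - a) (3/2 - b) (3/2 + b) 2 (by push_cast; ring)
  simpa only [Pk, Qk, div_eq_mul_inv] using this

lemma PQ_summable (a b : ℂ) : Summable (fun k : ℕ => ‖Pk a k * Qk b k‖) := by
  have h1 : (fun k : ℕ => (k:ℂ) ^ 2 * (Pk a k * Qk b k)) =O[atTop] fun _ => (1:ℝ) :=
    (PQ_lim a b).isBigO_one ℝ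
  have h2 : (fun k : ℕ => ‖Pk a k * Qk b k‖) =O[atTop] fun k : ℕ => 1 / (k:ℝ) ^ 2 := by
    have h3 : (fun k : ℕ => ((k:ℂ) ^ 2)⁻¹) =O[atTop] fun k : ℕ => 1 / (k:ℝ) ^ 2 := by
      refine Asymptotics.isBigO_of_le _ fun k => ?_
      simp
    have h4 := h3.mul h1
    simp only [mul_one] at h4
    refine (h4.congr' ?_ EventuallyEq.rfl).norm_left
    filter_upwards [eventually_ge_atTop 1] with n hn
    have hn0 : (n:ℂ) ≠ 0 := by exact_mod_cast (by omega : n ≠ 0)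
    field_simp
  exact summable_of_isBigO_nat (Real.summable_one_div_nat_pow.2 (by norm_num)) h2

lemma norm_half (k : ℕ) : ‖(k:ℂ) + 1/2‖ = (k:ℝ) + 1/2 := by
  have : (k:ℂ) + 1/2 = (((k:ℝ) + 1/2 : ℝ) : ℂ) := by push_cast; ring
  rw [this, Complex.norm_real, Real.norm_of_nonneg (by positivity)]

lemma half_ne (k : ℕ) : (k:ℂ) + 1/2 ≠ 0 := by
  rw [← norm_ne_zero_iff, norm_half]; positivity

lemma tk_summable (a b : ℂ) : Summable (tk a b) := by
  refine Summable.of_norm_bounded ((PQ_summable a b).mul_left 2) fun k => ?_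
  rw [tk, norm_div, norm_half, div_le_iff₀ (by positivity)]
  have : (0:ℝ) ≤ k := Nat.cast_nonneg k
  nlinarith [norm_nonneg (Pk a k * Qk b k)]

lemma PV_lim (a b c : ℂ) : Tendsto (fun k : ℕ => ((k:ℂ) + c) * (Pk a k * Vk b k)) atTop (𝓝 1) := by
  have := ratio2 (1/2 + a) (1/2 - a) (1/2 - b) (3/2 + b) 1 (by push_cast; ring)
  have h1 : Tendsto (fun k : ℕ => (k:ℂ) * (Pk a k * Vk b k)) atTop (𝓝 1) := by
    simpa only [Pk, Vk, div_eq_mul_inv, pow_one] using this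
  have hinv : Tendsto (fun k : ℕ => 1 + c * ((k:ℂ))⁻¹) atTop (𝓝 1) := by
    have := (tendsto_inv_atTop_nhds_zero_nat (𝕜 := ℂ)).const_mul c
    simpa using this.const_add 1
  have h2 := hinv.mul h1
  rw [mul_one] at h2
  refine h2.congr' ?_
  filter_upwards [eventually_ge_atTop 1] with n hn
  have hn0 : (n:ℂ) ≠ 0 := by exact_mod_cast (by omega : n ≠ 0)
  field_simp

lemma P_zero (a : ℂ) : Pk a 0 = Real.pi / Complex.cos (Real.pi * a) := by
  have h := Complex.Gamma_mul_Gamma_one_sub (1/2 + a)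
  rw [Pk]
  simp only [Nat.cast_zero, add_zero]
  rw [show 1/2 - a = 1 - (1/2 + a) by ring, h, show (Real.pi:ℂ) * (1/2 + a) = Real.pi * a + Real.pi / 2 by ring,
    Complex.sin_add_pi_div_two]

lemma cos_ne (a : ℂ) (hA : ∀ n : ℕ, 1/2 + a + n ≠ 0) (hB : ∀ n : ℕ, 1/2 - a + n ≠ 0) :
    Complex.cos (Real.pi * a) ≠ 0 := by
  intro h
  have h1 := P_zero a
  rw [h, div_zero, Pk, mul_eq_zero] at h1
  simp only [Nat.cast_zero, add_zero] at h1
  rcases h1 with h1 | h1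
  · rw [Complex.Gamma_eq_zero_iff] at h1
    obtain ⟨m, hm⟩ := h1
    exact hA m (by rw [hm]; ring)
  · rw [Complex.Gamma_eq_zero_iff] at h1
    obtain ⟨m, hm⟩ := h1
    exact hB m (by rw [hm]; ring)

lemma V_zero (b : ℂ) : (2 * b + 1) * Vk b 0 = 2 * Complex.cos (Real.pi * b) / Real.pi := by
  have h := P_zero b
  have h' := one_div_Gamma_eq_self_mul_one_div_Gamma_add_one (1/2 + b)
  rw [show 1/2 + b + 1 = 3/2 + b by ring] at h'
  have e : (2 * b + 1) * Vk b 0 = 2 * (Pk b 0)⁻¹ := by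
    rw [Vk, Pk]
    simp only [Nat.cast_zero, add_zero]
    rw [mul_inv, mul_inv, h']
    ring
  rw [e, h, inv_div]; ring

lemma recur (a b : ℂ) (hA : ∀ n : ℕ, 1/2 + a + n ≠ 0) (hB : ∀ n : ℕ, 1/2 - a + n ≠ 0)
    (hc : (b - a) * (b + a + 1) * (b + a) * (b - a + 1) ≠ 0) :
    Complex.cos (Real.pi * a) * (b * ∑' k, tk a b k + (b + 1) * ∑' k, tk a (b + 1) k) =
      ((2 * b + 1) * Complex.cos (Real.pi * a)
        - (1 + 2 * b * (b + 1) - 2 * a ^ 2) * Complex.cos (Real.pi * b)) /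
      ((b - a) * (b + a + 1) * (b + a) * (b - a + 1)) := by
  set c := (b - a) * (b + a + 1) * (b + a) * (b - a + 1) with hcdef
  set β := 1/2 + b * (b + 1) - a ^ 2 with hβ
  set v : ℕ → ℂ := fun k => ((k:ℂ) + β) * (Pk a k * Vk b k) with hv
  have hstep : ∀ k : ℕ, b * tk a b k + (b + 1) * tk a (b + 1) k = (2 * b + 1) / c * (v (k + 1) - v k) := by
    intro k
    have hk := half_ne k
    simp only [hv, tk]
    rw [Vk_succ, Vk_W, Pk_succ a hA hB, Qk_W, Qk_W']
    have e1 : b * (Pk a k * ((3/2 + b + k) * Wk b k) / (k + 1/2)) +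
      (b + 1) * (Pk a k * ((1/2 - b + k) * Wk b k) / (k + 1/2)) = (2 * b + 1) * (Pk a k * Wk b k) := by
      rw [mul_div_assoc', mul_div_assoc', ← add_div, div_eq_iff hk]
      ring
    rw [e1, div_mul_eq_mul_div, eq_div_iff hc, hβ, hcdef]
    push_cast
    ring
  have hsum : ∀ N : ℕ, ∑ k ∈ Finset.range N, (b * tk a b k + (b + 1) * tk a (b + 1) k) =
      (2 * b + 1) / c * (v N - v 0) := by
    intro N
    rw [Finset.sum_congr rfl fun k _ => hstep k, ← Finset.mul_sum, Finset.sum_range_sub]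
  have hS := ((tk_summable a b).mul_left b).add ((tk_summable a (b+1)).mul_left (b+1))
  have hlim := hS.hasSum.tendsto_sum_nat
  have hlim2 : Tendsto (fun N : ℕ => (2 * b + 1) / c * (v N - v 0)) atTop
      (𝓝 ((2 * b + 1) / c * (1 - v 0))) := ((PV_lim a b β).sub_const _).const_mul _
  have heq := tendsto_nhds_unique hlim (hlim2.congr fun N => (hsum N).symm)
  rw [((tk_summable a b).mul_left b).tsum_add ((tk_summable a (b+1)).mul_left (b+1)),
    tsum_mul_left, tsum_mul_left] at heq
  rw [heq]
  have hv0 : (2 * b + 1) * v 0 * Complex.cos (Real.pi * a) = 2 * β * Complex.cos (Real.pi * b) := by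
    have hV := V_zero b
    have hcos := cos_ne a hA hB
    have hpi : (Real.pi:ℂ) ≠ 0 := by exact_mod_cast Real.pi_ne_zero
    simp only [hv, Nat.cast_zero, zero_add]
    calc (2 * b + 1) * (β * (Pk a 0 * Vk b 0)) * Complex.cos (Real.pi * a)
        = β * Pk a 0 * Complex.cos (Real.pi * a) * ((2 * b + 1) * Vk b 0) := by ring
      _ = _ := by
        rw [hV, P_zero]; field_simp
  rw [eq_div_iff hc, hβ] at *
  field_simp
  linear_combination (-1 : ℂ) * hv0

lemma sin_nat (z : ℂ) (n : ℕ) : Complex.sin (z + n * Real.pi) = (-1) ^ n * Complex.sin z := by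
  induction n with
  | zero => simp
  | succ n ih =>
    rw [show z + ((n + 1 : ℕ) : ℂ) * Real.pi = z + n * Real.pi + Real.pi by push_cast; ring,
      Complex.sin_add_pi, ih]
    ring

lemma cos_nat (z : ℂ) (n : ℕ) : Complex.cos (z + n * Real.pi) = (-1) ^ n * Complex.cos z := by
  induction n with
  | zero => simp
  | succ n ih =>
    rw [show z + ((n + 1 : ℕ) : ℂ) * Real.pi = z + n * Real.pi + Real.pi by push_cast; ring,
      Complex.cos_add_pi, ih]
    ring

lemma Qk_decr (B : ℂ) (k : ℕ) (hs : |B.im| ≤ B.re) :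
    (B.re + 1 + (k + 1/2)) * ‖Qk (B + 1) k‖ ≤ (B.re + (k + 1/2)) * ‖Qk B k‖ := by
  have hk : (0:ℝ) ≤ k := Nat.cast_nonneg k
  have hs0 : 0 ≤ B.re := (abs_nonneg _).trans hs
  rw [Qk_W', Qk_W, norm_mul, norm_mul, ← mul_assoc, ← mul_assoc]
  refine mul_le_mul_of_nonneg_right ?_ (norm_nonneg _)
  rw [← pow_le_pow_iff_left₀ (by positivity) (by positivity) (two_ne_zero), mul_pow, mul_pow,
    Complex.sq_norm, Complex.sq_norm, Complex.normSq_apply, Complex.normSq_apply]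
  simp
  set s := B.re
  set t := B.im
  have h2 : t ^ 2 ≤ s ^ 2 := by rw [← sq_abs t]; gcongr
  obtain ⟨K, hK⟩ : ∃ K : ℝ, K = (k:ℝ) + 1/2 := ⟨_, rfl⟩
  have hkK : (k:ℝ) = K - 1/2 := by linarith
  have hK2 : 1/2 ≤ K := by linarith
  rw [hkK]
  have e1 : 2 * s * (s + K + 1) ^ 2 ≤ 4 * s * K * (s + K + 1) ^ 2 := by
    nlinarith [mul_nonneg (mul_nonneg hs0 (sq_nonneg (s + K + 1))) (by linarith : 0 ≤ K - 1/2)]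
  have e2 : 2 * s ^ 2 * (s + K + 1) ≤ 2 * s * (s + K + 1) ^ 2 := by
    nlinarith [mul_nonneg (mul_nonneg hs0 (by linarith : 0 ≤ s + K + 1)) (by linarith : 0 ≤ K + 1)]
  have e3 : (2 * (s + K) + 1) * t ^ 2 ≤ 2 * s ^ 2 * (s + K + 1) := by
    have : (2 * (s + K) + 1) * t ^ 2 ≤ (2 * (s + K) + 1) * s ^ 2 :=
      mul_le_mul_of_nonneg_left h2 (by linarith)
    nlinarith [sq_nonneg s]
  nlinarith [e1, e2, e3]

lemma Qk_bound (b : ℂ) (k : ℕ) (hs : |b.im| ≤ b.re) (n : ℕ) :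
    (b.re + n + (k + 1/2)) * ‖Qk (b + n) k‖ ≤ (b.re + (k + 1/2)) * ‖Qk b k‖ := by
  induction n with
  | zero => simp
  | succ n ih =>
    refine le_trans ?_ ih
    have hn : (0:ℝ) ≤ n := Nat.cast_nonneg n
    have := Qk_decr (b + n) k (by simp; linarith)
    push_cast
    simp only [add_re, natCast_re] at this
    rw [show b + ((n:ℂ) + 1) = b + n + 1 by ring, show b.re + ((n:ℝ) + 1) = b.re + n + 1 by ring]
    exact this

lemma Q_pointwise (b : ℂ) (k : ℕ) :
    Tendsto (fun n : ℕ => (b + n) * Qk (b + n) k) atTop (𝓝 0) := by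
  have h1 := ratio2 (b - k - 1/2) 1 (3/2 + b + k) 1 (2 * k + 2) (by push_cast; ring)
  have hinv0 := tendsto_inv_atTop_nhds_zero_nat (𝕜 := ℂ)
  have hinv : Tendsto (fun n : ℕ => 1 + b * ((n:ℂ))⁻¹) atTop (𝓝 1) := by
    have := hinv0.const_mul b
    simpa using this.const_add 1
  have hp : Tendsto (fun n : ℕ => ((n:ℂ)⁻¹) ^ (2 * k + 1)) atTop (𝓝 0) := by
    have := hinv0.pow (2 * k + 1)
    simpa using this
  have h2 := (((hinv.mul h1).mul hp).mul_const (Complex.sin (Real.pi * (b - k - 1/2)) / Real.pi)).norm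
  simp only [mul_zero, zero_mul, norm_zero] at h2
  rw [tendsto_zero_iff_norm_tendsto_zero]
  refine h2.congr' ?_
  filter_upwards [eventually_ge_atTop 1, eventually_gt_atTop ⌈‖b - k - 1/2‖⌉₊] with n hn hn2
  have hn0 : (n:ℂ) ≠ 0 := by exact_mod_cast (by omega : n ≠ 0)
  have hn1 : ‖b - k - 1/2‖ < n := Nat.lt_of_ceil_lt hn2
  have hG1 : Gamma (1 + n) ≠ 0 := by
    apply Complex.Gamma_ne_zero_of_re_pos
    simp; positivity
  have hGw : Gamma (b - k - 1/2 + n) ≠ 0 := by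
    apply Complex.Gamma_ne_zero_of_re_pos
    have := (abs_le.1 (Complex.abs_re_le_norm (b - k - 1/2))).1
    rw [add_re, natCast_re]
    linarith
  have hpi : (Real.pi:ℂ) ≠ 0 := by exact_mod_cast Real.pi_ne_zero
  have hrefl := Complex.Gamma_mul_Gamma_one_sub (b - k - 1/2 + n)
  have hr2 : (Gamma (3/2 - (b + n) + k))⁻¹ = Gamma (b - k - 1/2 + n) * Complex.sin (Real.pi * (b - k - 1/2 + n)) / Real.pi := by
    rw [show 3/2 - (b + n) + (k:ℂ) = 1 - (b - k - 1/2 + n) by ring]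
    have : Gamma (1 - (b - k - 1/2 + n)) = Real.pi / Complex.sin (Real.pi * (b - k - 1/2 + n)) / Gamma (b - k - 1/2 + n) := by
      rw [← hrefl, mul_div_cancel_left₀ _ hGw]
    rw [this, inv_div, div_div_eq_mul_div]
  have hsin : Complex.sin (Real.pi * (b - k - 1/2 + n)) = (-1) ^ n * Complex.sin (Real.pi * (b - k - 1/2)) := by
    rw [show (Real.pi:ℂ) * (b - k - 1/2 + n) = Real.pi * (b - k - 1/2) + n * Real.pi by ring,
      sin_nat]
  have hQ : (b + n) * Qk (b + n) k = (-1) ^ n * ((1 + b * ((n:ℂ))⁻¹) * ((n:ℂ) ^ (2 * k + 2) *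
      (Gamma (b - k - 1/2 + n) * Gamma (1 + n) / (Gamma (3/2 + b + k + n) * Gamma (1 + n)))) *
      ((n:ℂ)⁻¹) ^ (2 * k + 1) * (Complex.sin (Real.pi * (b - k - 1/2)) / Real.pi)) := by
    rw [mul_div_mul_right _ _ hG1, Qk, mul_inv, hr2, hsin,
      show 3/2 + (b + n) + (k:ℂ) = 3/2 + b + k + n by ring]
    have e : (n:ℂ) ^ (2 * k + 2) * ((n:ℂ)⁻¹) ^ (2 * k + 1) = n := by
      rw [inv_pow, pow_succ (n:ℂ) (2 * k + 1)]; field_simp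
    have e2 : (1 + b * ((n:ℂ))⁻¹) * n = b + n := by field_simp; ring
    rw [div_eq_mul_inv (Gamma (b - k - 1/2 + n))]
    rw [← e2]
    linear_combination (-(-1) ^ n * (1 + b * ((n:ℂ))⁻¹) * Gamma (b - k - 1/2 + n) * (Gamma (3/2 + b + k + n))⁻¹ * (Complex.sin (Real.pi * (b - k - 1/2)) / Real.pi)) * e
  rw [hQ, norm_mul ((-1) ^ n), norm_pow, norm_neg, norm_one, one_pow, one_mul]

lemma tail0 (a b : ℂ) (hs : |b.im| ≤ b.re) :
    Tendsto (fun n : ℕ => (b + n) * ∑' k, tk a (b + n) k) atTop (𝓝 0) := by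
  have hs0 : 0 ≤ b.re := (abs_nonneg _).trans hs
  have h := tendsto_tsum_of_dominated_convergence (𝓕 := atTop)
    (f := fun (n : ℕ) (k : ℕ) => (b + n) * tk a (b + n) k) (g := fun _ => 0)
    (bound := fun k => 2 * (2 * b.re + 1) * ‖Pk a k * Qk b k‖)
    ((PQ_summable a b).mul_left _) ?_ ?_
  · simpa only [tsum_mul_left, tsum_zero] using h
  · intro k
    have := (Q_pointwise b k).mul_const (Pk a k / (k + 1/2))
    rw [zero_mul] at this
    refine this.congr fun n => ?_
    rw [tk]; ring
  · refine Eventually.of_forall fun n k => ?_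
    have hk : (0:ℝ) ≤ k := Nat.cast_nonneg k
    have hn : (0:ℝ) ≤ n := Nat.cast_nonneg n
    have hb := Qk_bound b k hs n
    have hnb : ‖b + n‖ ≤ 2 * (b.re + n) := by
      have := Complex.norm_le_abs_re_add_abs_im (b + n)
      simp only [add_re, natCast_re, add_im, natCast_im, add_zero] at this
      rw [abs_of_nonneg (by linarith : 0 ≤ b.re + n)] at this
      linarith
    have h1 : ‖b + n‖ * ‖Qk (b + n) k‖ ≤ 2 * ((b.re + (k + 1/2)) * ‖Qk b k‖) := by
      have e : ‖b + n‖ * ‖Qk (b + n) k‖ ≤ 2 * (b.re + n) * ‖Qk (b + n) k‖ :=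
        mul_le_mul_of_nonneg_right hnb (norm_nonneg _)
      nlinarith [norm_nonneg (Qk (b + n) k)]
    have h2 : b.re + (k + 1/2) ≤ (2 * b.re + 1) * ((k:ℝ) + 1/2) := by nlinarith
    have hq := norm_nonneg (Qk b k)
    have hp := norm_nonneg (Pk a k)
    rw [tk, norm_mul, norm_div, norm_half, norm_mul, norm_mul, mul_div_assoc', div_le_iff₀ (by positivity)]
    calc ‖b + n‖ * (‖Pk a k‖ * ‖Qk (b + n) k‖) = ‖Pk a k‖ * (‖b + n‖ * ‖Qk (b + n) k‖) := by ring
      _ ≤ ‖Pk a k‖ * (2 * ((b.re + (k + 1/2)) * ‖Qk b k‖)) := by gcongr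
      _ ≤ ‖Pk a k‖ * (2 * (((2 * b.re + 1) * ((k:ℝ) + 1/2)) * ‖Qk b k‖)) := by gcongr
      _ = _ := by ring

lemma tail (a b : ℂ) :
    Tendsto (fun n : ℕ => (b + n) * ∑' k, tk a (b + n) k) atTop (𝓝 0) := by
  obtain ⟨m, hm⟩ := exists_nat_gt (|b.im| - b.re)
  rw [← tendsto_add_atTop_iff_nat m]
  have := tail0 a (b + m) (by simp; linarith)
  refine this.congr fun n => ?_
  push_cast
  rw [show b + ((n:ℂ) + m) = b + m + n by ring]

lemma digamma_dup (x : ℂ) (hx : ∀ n : ℕ, 1 + 2 * x + n ≠ 0) :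
    digamma (1/2 + x) + digamma (1 + x) = 2 * digamma (1 + 2 * x) - 2 * Complex.log 2 := by
  have p1 : ∀ m : ℕ, 1/2 + x ≠ -m := fun m h => hx (2 * m) (by push_cast; linear_combination 2 * h)
  have p2 : ∀ m : ℕ, 1 + x ≠ -m := fun m h => hx (2 * m + 1) (by push_cast; linear_combination 2 * h)
  have p3 : ∀ m : ℕ, 1 + 2 * x ≠ -m := fun m h => hx m (by linear_combination h)
  have d1 := (differentiableAt_Gamma _ p1).hasDerivAt
  have d2 := (differentiableAt_Gamma _ p2).hasDerivAt
  have d3 := (differentiableAt_Gamma _ p3).hasDerivAt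
  have e1 : HasDerivAt (fun z : ℂ => Gamma (1/2 + z)) (deriv Gamma (1/2 + x)) x :=
    HasDerivAt.comp_const_add (1/2) x d1
  have e2 : HasDerivAt (fun z : ℂ => Gamma (1 + z)) (deriv Gamma (1 + x)) x :=
    HasDerivAt.comp_const_add 1 x d2
  have l3 : HasDerivAt (fun z : ℂ => 1 + 2 * z) 2 x := by
    simpa using ((hasDerivAt_id x).const_mul 2).const_add 1
  have e3 : HasDerivAt (fun z : ℂ => Gamma (1 + 2 * z)) (deriv Gamma (1 + 2 * x) * 2) x :=
    HasDerivAt.comp x d3 l3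
  have l4 : HasDerivAt (fun z : ℂ => -2 * z) (-2) x := by
    simpa using (hasDerivAt_id x).const_mul (-2)
  have e4 : HasDerivAt (fun z : ℂ => (2:ℂ) ^ (-2 * z)) ((2:ℂ) ^ (-2 * x) * Complex.log 2 * (-2)) x :=
    l4.const_cpow (Or.inl two_ne_zero)
  have hL := e1.mul e2
  have hR := (e3.mul e4).mul_const ((√Real.pi : ℝ) : ℂ)
  have hfun : ∀ z : ℂ, Gamma (1/2 + z) * Gamma (1 + z) =
      Gamma (1 + 2 * z) * (2:ℂ) ^ (-2 * z) * ((√Real.pi : ℝ) : ℂ) := by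
    intro z
    have := Complex.Gamma_mul_Gamma_add_half (1/2 + z)
    rw [show 1/2 + z + 1/2 = 1 + z by ring, show 2 * (1/2 + z) = 1 + 2 * z by ring,
      show 1 - (1 + 2 * z) = -2 * z by ring] at this
    exact this
  have hL' : HasDerivAt (fun z : ℂ => Gamma (1 + 2 * z) * (2:ℂ) ^ (-2 * z) * ((√Real.pi : ℝ) : ℂ))
      (deriv Gamma (1/2 + x) * Gamma (1 + x) + Gamma (1/2 + x) * deriv Gamma (1 + x)) x :=
    hL.congr_of_eventuallyEq (Eventually.of_forall fun z => (hfun z).symm)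
  have key := hL'.unique hR
  have g1 := Complex.Gamma_ne_zero p1
  have g2 := Complex.Gamma_ne_zero p2
  have g3 := Complex.Gamma_ne_zero p3
  have hx' := hfun x
  simp only [digamma_def, logDeriv_apply]
  have k1 : deriv Gamma (1/2 + x) / Gamma (1/2 + x) + deriv Gamma (1 + x) / Gamma (1 + x) =
      (deriv Gamma (1/2 + x) * Gamma (1 + x) + Gamma (1/2 + x) * deriv Gamma (1 + x)) /
        (Gamma (1/2 + x) * Gamma (1 + x)) := by
    rw [div_add_div _ _ g1 g2]
  rw [k1, key, hx']
  have hne : (2:ℂ) ^ (-2 * x) ≠ 0 := by simp [cpow_eq_zero_iff]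
  have hpi : ((√Real.pi : ℝ) : ℂ) ≠ 0 := by
    exact_mod_cast (Real.sqrt_pos.2 Real.pi_pos).ne'
  generalize (2:ℂ) ^ (-2 * x) = A at *
  field_simp
  ring

noncomputable def Rf (x y : ℂ) : ℂ :=
  Complex.sin (Real.pi * x) * Complex.sin (Real.pi * y) *
    ((x - y) / (2 * x * y) + (digamma (1 + x) - digamma (1 + y)))
  - Complex.cos (Real.pi * x) * Complex.cos (Real.pi * y) * (digamma (1/2 + x) - digamma (1/2 + y))

lemma digamma_shift (x : ℂ) (hx : ∀ n : ℕ, 2 * x + n ≠ 0) :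
    digamma (1 + (x + 1/2)) = digamma (1/2 + x) + (1/2 + x)⁻¹ := by
  rw [show 1 + (x + 1/2) = (1/2 + x) + 1 by ring, digamma_apply_add_one]
  intro m h
  exact hx (2 * m + 1) (by push_cast; linear_combination 2 * h)

lemma Rf_step (x y : ℂ) (hx : ∀ n : ℕ, 2 * x + n ≠ 0) (hy : ∀ n : ℕ, 2 * y + n ≠ 0) :
    Rf (x + 1/2) (y + 1/2) + Rf x y =
      (x - y) * (((2 * (x + y) + 1) * Complex.cos (Real.pi * (x - y))
        - (1 + 2 * (x + y) * (x + y + 1) - 2 * (x - y) ^ 2) * Complex.cos (Real.pi * (x + y))) /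
      ((x + y - (x - y)) * (x + y + (x - y) + 1) * (x + y + (x - y)) * (x + y - (x - y) + 1))) := by
  have x0 : x ≠ 0 := fun h => hx 0 (by simp [h])
  have y0 : y ≠ 0 := fun h => hy 0 (by simp [h])
  have x1 : 2 * x + 1 ≠ 0 := by simpa using hx 1
  have y1 : 2 * y + 1 ≠ 0 := by simpa using hy 1
  have x2 : x + 1/2 ≠ 0 := fun h => x1 (by linear_combination 2 * h)
  have y2 : y + 1/2 ≠ 0 := fun h => y1 (by linear_combination 2 * h)
  have s1 : ∀ z : ℂ, Complex.sin (Real.pi * (z + 1/2)) = Complex.cos (Real.pi * z) := by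
    intro z
    rw [show (Real.pi:ℂ) * (z + 1/2) = Real.pi * z + Real.pi / 2 by ring, Complex.sin_add_pi_div_two]
  have s2 : ∀ z : ℂ, Complex.cos (Real.pi * (z + 1/2)) = -Complex.sin (Real.pi * z) := by
    intro z
    rw [show (Real.pi:ℂ) * (z + 1/2) = Real.pi * z + Real.pi / 2 by ring, Complex.cos_add_pi_div_two]
  rw [Rf, Rf, s1, s1, s2, s2, digamma_shift x hx, digamma_shift y hy,
    show 1/2 + (x + 1/2) = 1 + x by ring, show 1/2 + (y + 1/2) = 1 + y by ring,
    mul_sub (Real.pi:ℂ) x y, mul_add (Real.pi:ℂ) x y, Complex.cos_sub, Complex.cos_add,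
    show x + y - (x - y) = 2 * y by ring, show x + y + (x - y) = 2 * x by ring,
    show 1/2 + x = (2 * x + 1) / 2 by ring, show 1/2 + y = (2 * y + 1) / 2 by ring,
    show x + 1/2 = (2 * x + 1) / 2 by ring, show y + 1/2 = (2 * y + 1) / 2 by ring]
  generalize Complex.cos (Real.pi * x) = cx
  generalize Complex.cos (Real.pi * y) = cy
  generalize Complex.sin (Real.pi * x) = sx
  generalize Complex.sin (Real.pi * y) = sy
  generalize digamma (1 + x) = p1
  generalize digamma (1 + y) = p2
  generalize digamma ((2 * x + 1) / 2) = p3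
  generalize digamma ((2 * y + 1) / 2) = p4
  have e : cx * cy * (((2 * x + 1) / 2 - (2 * y + 1) / 2) / (2 * ((2 * x + 1) / 2) * ((2 * y + 1) / 2)) +
      (p3 + ((2 * x + 1) / 2)⁻¹ - (p4 + ((2 * y + 1) / 2)⁻¹))) - -sx * -sy * (p1 - p2) +
      (sx * sy * ((x - y) / (2 * x * y) + (p1 - p2)) - cx * cy * (p3 - p4)) =
      cx * cy * (((2 * x + 1) / 2 - (2 * y + 1) / 2) / (2 * ((2 * x + 1) / 2) * ((2 * y + 1) / 2)) +
      (((2 * x + 1) / 2)⁻¹ - (((2 * y + 1) / 2)⁻¹))) + sx * sy * ((x - y) / (2 * x * y)) := by ring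
  rw [e]
  field_simp
  ring

lemma Rf_lim (x y : ℂ) :
    Tendsto (fun m : ℕ => Rf (x + m) (y + m)) atTop (𝓝 0) := by
  have h1 := digamma_diff (1 + x) (1 + y)
  have h2 := digamma_diff (1/2 + x) (1/2 + y)
  have hi : ∀ z : ℂ, Tendsto (fun m : ℕ => (z + m)⁻¹) atTop (𝓝 0) := by
    intro z
    have h := tendsto_natCast_div_add_atTop (𝕜 := ℂ) z
    have h' := h.mul (tendsto_inv_atTop_nhds_zero_nat (𝕜 := ℂ))
    rw [mul_zero] at h'
    refine h'.congr' ?_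
    filter_upwards [eventually_ge_atTop 1] with n hn
    have hn0 : (n:ℂ) ≠ 0 := by exact_mod_cast (by omega : n ≠ 0)
    rw [add_comm z, div_mul_eq_mul_div, mul_inv_cancel₀ hn0, one_div]
  have h3 : Tendsto (fun m : ℕ => (x - y) / 2 * ((x + m)⁻¹ * (y + m)⁻¹)) atTop (𝓝 0) := by
    simpa using ((hi x).mul (hi y)).const_mul ((x - y) / 2)
  have h4 := ((h3.add h1).const_mul (Complex.sin (Real.pi * x) * Complex.sin (Real.pi * y))).sub
    (h2.const_mul (Complex.cos (Real.pi * x) * Complex.cos (Real.pi * y)))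
  simp only [add_zero, mul_zero, sub_zero] at h4
  refine h4.congr fun m => ?_
  have s1 : ∀ z : ℂ, Complex.sin (Real.pi * (z + m)) = (-1) ^ m * Complex.sin (Real.pi * z) := by
    intro z
    rw [show (Real.pi:ℂ) * (z + m) = Real.pi * z + m * Real.pi by ring, sin_nat]
  have s2 : ∀ z : ℂ, Complex.cos (Real.pi * (z + m)) = (-1) ^ m * Complex.cos (Real.pi * z) := by
    intro z
    rw [show (Real.pi:ℂ) * (z + m) = Real.pi * z + m * Real.pi by ring, cos_nat]
  have hm : ((-1:ℂ) ^ m) * (-1) ^ m = 1 := by rw [← mul_pow]; simp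
  rw [Rf, s1, s1, s2, s2]
  have a1 : ∀ A B : ℂ, (-1) ^ m * A * ((-1) ^ m * B) = A * B := by
    intro A B
    linear_combination A * B * hm
  rw [a1, a1, ← add_assoc, ← add_assoc, ← add_assoc, ← add_assoc]
  congr 3
  rw [add_sub_add_right_eq_sub, div_eq_mul_inv, div_eq_mul_inv, mul_inv, mul_inv]
  ring

lemma main_eq (x y : ℂ) (hA : ∀ n : ℕ, 1/2 + (x - y) + n ≠ 0) (hB : ∀ n : ℕ, 1/2 - (x - y) + n ≠ 0)
    (hx : ∀ n : ℕ, 2 * x + n ≠ 0) (hy : ∀ n : ℕ, 2 * y + n ≠ 0) :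
    Complex.cos (Real.pi * (x - y)) * (x - y) * ((x + y) * ∑' k, tk (x - y) (x + y) k) = Rf x y := by
  set E : ℕ → ℂ := fun n => Complex.cos (Real.pi * (x - y)) * (x - y) *
    ((x + y + n) * ∑' k, tk (x - y) (x + y + n) k) - Rf (x + n / 2) (y + n / 2) with hE
  have hstep : ∀ n, E (n + 1) = - E n := by
    intro n
    have hx' : ∀ m : ℕ, 2 * (x + n / 2) + m ≠ 0 := fun m h =>
      hx (n + m) (by push_cast; linear_combination h)
    have hy' : ∀ m : ℕ, 2 * (y + n / 2) + m ≠ 0 := fun m h =>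
      hy (n + m) (by push_cast; linear_combination h)
    have r := Rf_step _ _ hx' hy'
    rw [show x + (n:ℂ) / 2 - (y + n / 2) = x - y by ring,
      show x + (n:ℂ) / 2 + (y + n / 2) = x + y + n by ring] at r
    have hc : (x + y + n - (x - y)) * (x + y + n + (x - y) + 1) * (x + y + n + (x - y)) *
        (x + y + n - (x - y) + 1) ≠ 0 := by
      have a1 := hx' 0
      have a2 := hx' 1
      have a3 := hy' 0
      have a4 := hy' 1
      refine mul_ne_zero (mul_ne_zero (mul_ne_zero ?_ ?_) ?_) ?_
      · intro h; exact a3 (by push_cast; linear_combination h)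
      · intro h; exact a2 (by push_cast; linear_combination h)
      · intro h; exact a1 (by push_cast; linear_combination h)
      · intro h; exact a4 (by push_cast; linear_combination h)
    have q := recur (x - y) (x + y + n) hA hB hc
    rw [← q] at r
    simp only [hE]
    push_cast
    rw [show x + ((n:ℂ) + 1) / 2 = x + n / 2 + 1/2 by ring,
      show y + ((n:ℂ) + 1) / 2 = y + n / 2 + 1/2 by ring,
      show x + y + ((n:ℂ) + 1) = x + y + n + 1 by ring]
    linear_combination -r
  have heven : ∀ m : ℕ, E (2 * m) = E 0 := by
    intro m
    induction m with
    | zero => rfl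
    | succ m ih => rw [show 2 * (m + 1) = 2 * m + 1 + 1 by ring, hstep, hstep, neg_neg, ih]
  have ht : Tendsto (fun m : ℕ => 2 * m) atTop atTop :=
    tendsto_id.const_mul_atTop' (by norm_num)
  have hl1 := ((tail (x - y) (x + y)).const_mul (Complex.cos (Real.pi * (x - y)) * (x - y))).comp ht
  have hl := hl1.sub (Rf_lim x y)
  simp only [mul_zero, sub_zero] at hl
  have hl' : Tendsto (fun _ : ℕ => E 0) atTop (𝓝 0) := by
    refine hl.congr fun m => ?_
    rw [← heven m]
    simp only [hE, Function.comp]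
    push_cast
    rw [show x + 2 * (m:ℂ) / 2 = x + m by ring, show y + 2 * (m:ℂ) / 2 = y + m by ring]
  have h0 := tendsto_nhds_unique hl' tendsto_const_nhds
  have : E 0 = Complex.cos (Real.pi * (x - y)) * (x - y) * ((x + y) * ∑' k, tk (x - y) (x + y) k) - Rf x y := by
    simp [hE]
  rw [this] at h0
  linear_combination -h0
end GenFun

open GenFun in
/-- The closed form of the generating function of
`t({2}^n, 3, {2}^m)`: the series
`∑_{k≥0} 2 cos(π(x−y)) Γ(k+x−y+1/2) Γ(k−x+y+1/2) / ((2k+1) Γ(k−x−y+3/2) Γ(k+x+y+3/2))`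
equals an explicit digamma/trigonometric expression. -/
theorem genfun_t2232 (x y : ℂ)
    (hxy : x ≠ y) (hxy' : x ≠ -y) (hx0 : x ≠ 0) (hy0 : y ≠ 0)
    (hA : ∀ n : ℕ, x - y + 1/2 ≠ -(n : ℂ))
    (hB : ∀ n : ℕ, y - x + 1/2 ≠ -(n : ℂ))
    (h1 : ∀ n : ℕ, 1 + x ≠ -(n : ℂ))
    (h2 : ∀ n : ℕ, 1 + y ≠ -(n : ℂ))
    (h3 : ∀ n : ℕ, 1 + 2 * x ≠ -(n : ℂ))
    (h4 : ∀ n : ℕ, 1 + 2 * y ≠ -(n : ℂ)) :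
    ∑' k : ℕ, 2 * Complex.cos (Real.pi * (x - y)) *
        Complex.Gamma ((k : ℂ) + x - y + 1/2) * Complex.Gamma ((k : ℂ) - x + y + 1/2) /
        ((2 * (k : ℂ) + 1) * Complex.Gamma ((k : ℂ) - x - y + 3/2) *
          Complex.Gamma ((k : ℂ) + x + y + 3/2)) =
      Complex.sin (Real.pi * x) * Complex.sin (Real.pi * y) / (2 * x * y * (x + y))
      + Complex.cos (Real.pi * (x - y)) / (x ^ 2 - y ^ 2) *
          (digammaC (1 + x) - digammaC (1 + y))
      - 2 * Complex.cos (Real.pi * x) * Complex.cos (Real.pi * y) / (x ^ 2 - y ^ 2) *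
          (digammaC (1 + 2 * x) - digammaC (1 + 2 * y)) := by
  have hd : ∀ z, digammaC z = Complex.digamma z := fun z => rfl
  simp only [hd]
  have hx : ∀ n : ℕ, 2 * x + n ≠ 0 := by
    intro n h
    rcases n with _ | n
    · simp at h; exact hx0 h
    · exact h3 n (by push_cast at h; linear_combination h)
  have hy : ∀ n : ℕ, 2 * y + n ≠ 0 := by
    intro n h
    rcases n with _ | n
    · simp at h; exact hy0 h
    · exact h4 n (by push_cast at h; linear_combination h)
  have key := main_eq x y (fun n h => hA n (by linear_combination h))
    (fun n h => hB n (by linear_combination h)) hx hy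
  have hterm : ∀ k : ℕ, 2 * Complex.cos (Real.pi * (x - y)) *
        Complex.Gamma ((k : ℂ) + x - y + 1/2) * Complex.Gamma ((k : ℂ) - x + y + 1/2) /
        ((2 * (k : ℂ) + 1) * Complex.Gamma ((k : ℂ) - x - y + 3/2) *
          Complex.Gamma ((k : ℂ) + x + y + 3/2)) =
      Complex.cos (Real.pi * (x - y)) * tk (x - y) (x + y) k := by
    intro k
    rw [tk, Pk, Qk, show (k:ℂ) + x - y + 1/2 = 1/2 + (x - y) + k by ring,
      show (k:ℂ) - x + y + 1/2 = 1/2 - (x - y) + k by ring,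
      show (k:ℂ) - x - y + 3/2 = 3/2 - (x + y) + k by ring,
      show (k:ℂ) + x + y + 3/2 = 3/2 + (x + y) + k by ring,
      show 2 * (k:ℂ) + 1 = 2 * (k + 1/2) by ring]
    simp only [div_eq_mul_inv, mul_inv]
    ring
  rw [tsum_congr hterm, tsum_mul_left]
  have d1 := digamma_dup x (fun n h => h3 n (by linear_combination h))
  have d2 := digamma_dup y (fun n h => h4 n (by linear_combination h))
  have f1 : x - y ≠ 0 := sub_ne_zero.2 hxy
  have f2 : x + y ≠ 0 := fun h => hxy' (by linear_combination h)
  have f3 : x ^ 2 - y ^ 2 = (x - y) * (x + y) := by ring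
  have d1' : Complex.digamma (1/2 + x) = 2 * Complex.digamma (1 + 2 * x) - 2 * Complex.log 2 - Complex.digamma (1 + x) := by
    linear_combination d1
  have d2' : Complex.digamma (1/2 + y) = 2 * Complex.digamma (1 + 2 * y) - 2 * Complex.log 2 - Complex.digamma (1 + y) := by
    linear_combination d2
  rw [Rf, d1', d2'] at key
  rw [mul_sub (Real.pi:ℂ) x y, Complex.cos_sub] at key
  rw [f3, mul_sub (Real.pi:ℂ) x y, Complex.cos_sub]
  clear hterm
  generalize (∑' k, tk (x - y) (x + y) k) = S at *
  generalize Complex.cos (Real.pi * x) = cx at *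
  generalize Complex.cos (Real.pi * y) = cy at *
  generalize Complex.sin (Real.pi * x) = sx at *
  generalize Complex.sin (Real.pi * y) = sy at *
  generalize Complex.digamma (1 + x) = p1 at *
  generalize Complex.digamma (1 + y) = p2 at *
  generalize Complex.digamma (1 + 2 * x) = p3 at *
  generalize Complex.digamma (1 + 2 * y) = p4 at *
  have k2 : (cx * cy + sx * sy) * S = (sx * sy * ((x - y) / (2 * x * y) + (p1 - p2)) - cx * cy * (2 * p3 - 2 * Complex.log 2 - p1 - (2 * p4 - 2 * Complex.log 2 - p2))) / ((x - y) * (x + y)) := by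
    rw [eq_div_iff (mul_ne_zero f1 f2)]
    linear_combination key
  rw [k2]
  field_simp
  ring
end
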